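/- arXiv:math/0701093 — 4 statements merged into one kernel-verified Lean document; each statement's English description precedes it below -/
import Mathlib

section
/- Let $k$ be a field and $V$ a closed subscheme of $\mathbb{P}_k^n \times \mathbb{P}_k^n$. If $\dim V \geq n$, then $V$ meets the diagonal $\Delta = \{(x,x) : x \in \mathbb{P}_k^n\}$, i.e. $V \cap \Delta \neq \emptyset$. -/
open MvPolynomial

theorem ringKrullDim_le_of_finite_hom {A B : Type*} [CommRing A] [CommRing B] (f : A →+* B)
    (hf : f.Finite) : ringKrullDim B ≤ ringKrullDim A := by
  let _ := f.toAlgebra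
  have hfin : Module.Finite A B := hf
  have hint : Algebra.IsIntegral A B := inferInstance
  refine Order.krullDim_le_of_strictMono (fun p : PrimeSpectrum B => p.comap (algebraMap A B)) ?_
  intro p q hpq
  exact Ideal.IsIntegral.comap_lt_comap (R := A) (I := p.asIdeal) (J := q.asIdeal) hpq

section
attribute [local instance] MvPolynomial.gradedAlgebra

theorem homogeneousComponent_mul_aux {σ k : Type*} [Field k] {z : MvPolynomial σ k}
    (hz : z ∈ homogeneousSubmodule σ k 1) (g : MvPolynomial σ k) (e : ℕ) :
    homogeneousComponent (1 + e) (z * g) = z * homogeneousComponent e g := by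
  have h := DirectSum.coe_decompose_mul_add_of_left_mem (homogeneousSubmodule σ k) (i := 1)
    (j := e) (b := g) hz
  rw [← decomposition.decompose'_apply, ← decomposition.decompose'_apply]
  exact h

theorem finite_of_pow_le {σ ι k : Type*} [Field k] [Finite σ] [Fintype ι]
    (I : Ideal (MvPolynomial σ k)) (hI : I.IsHomogeneous (homogeneousSubmodule σ k))
    (z : ι → MvPolynomial σ k) (hz : ∀ i, z i ∈ homogeneousSubmodule σ k 1) (M : ℕ)
    (hM : idealOfVars σ k ^ M ≤ I ⊔ Ideal.span (Set.range z)) :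
    ((Ideal.Quotient.mk I).comp (aeval z : MvPolynomial ι k →ₐ[k] MvPolynomial σ k).toRingHom).Finite := by
  set ψ := (Ideal.Quotient.mk I).comp
    (aeval z : MvPolynomial ι k →ₐ[k] MvPolynomial σ k).toRingHom with hψ
  let alg : Algebra (MvPolynomial ι k) (MvPolynomial σ k ⧸ I) := ψ.toAlgebra
  let md : Module (MvPolynomial ι k) (MvPolynomial σ k ⧸ I) := alg.toModule
  have hsm : ∀ (a : MvPolynomial ι k) (b : MvPolynomial σ k),
      a • Ideal.Quotient.mk I b = Ideal.Quotient.mk I (aeval z a * b) := by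
    intro a b
    rw [Algebra.smul_def, map_mul]
    rfl
  let S : Set (MvPolynomial σ k ⧸ I) :=
    (fun d : σ →₀ ℕ => Ideal.Quotient.mk I (monomial d 1)) '' {d | d.degree ≤ M}
  have hS : S.Finite := (Finsupp.finite_of_degree_le M).image _
  let N : Submodule (MvPolynomial ι k) (MvPolynomial σ k ⧸ I) := Submodule.span _ S
  have hC : ∀ (c : k) (b : MvPolynomial σ k), Ideal.Quotient.mk I b ∈ N →
      Ideal.Quotient.mk I (C c * b) ∈ N := by
    intro c b hb
    have := N.smul_mem (C c) hb
    rw [hsm] at this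
    simpa [algebraMap_eq] using this
  have key : ∀ d : ℕ, ∀ f : MvPolynomial σ k, f.IsHomogeneous d →
      Ideal.Quotient.mk I f ∈ N := by
    intro d
    induction d using Nat.strong_induction_on with
    | _ d ih =>
    intro f hf
    by_cases hd : d ≤ M
    · rw [f.as_sum, map_sum]
      refine N.sum_mem fun m hm => ?_
      have : monomial m (coeff m f) = C (coeff m f) * monomial m 1 := by
        rw [C_mul_monomial, mul_one]
      rw [this]
      refine hC _ _ (Submodule.subset_span ⟨m, ?_, rfl⟩)
      have := hf.degree_eq_sum_deg_support hm
      simp only [Set.mem_setOf_eq]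
      rw [Finsupp.degree_apply]
      exact this ▸ hd
    · obtain ⟨e, rfl⟩ : ∃ e, d = 1 + e := ⟨d - 1, by omega⟩
      have hfM : f ∈ idealOfVars σ k ^ M := by
        rw [mem_pow_idealOfVars_iff]
        intro m hm
        have := hf.degree_eq_sum_deg_support hm
        rw [Finsupp.degree_apply]
        omega
      obtain ⟨a, ha, b, hb, hab⟩ := Submodule.mem_sup.mp (hM hfM)
      obtain ⟨g, hg⟩ := Ideal.mem_span_range_iff_exists_fun.mp hb
      have hf' : f = homogeneousComponent (1 + e) a +
          ∑ i, z i * homogeneousComponent e (g i) := by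
        rw [← homogeneousComponent_eq_self hf]
        conv_lhs => rw [← hab, ← hg]
        rw [map_add, map_sum]
        congr 1
        refine Finset.sum_congr rfl fun i _ => ?_
        rw [mul_comm, homogeneousComponent_mul_aux (hz i)]
      rw [hf', map_add, Ideal.Quotient.eq_zero_iff_mem.mpr
        (homogeneousComponent_mem_of_mem hI ha _), zero_add, map_sum]
      refine N.sum_mem fun i _ => ?_
      have := N.smul_mem (X i) (ih e (by omega) _ (homogeneousComponent_isHomogeneous e (g i)))
      rw [hsm] at this
      simpa using this
  refine ⟨⟨hS.toFinset, ?_⟩⟩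
  rw [Set.Finite.coe_toFinset, eq_top_iff]
  rintro x -
  obtain ⟨f, rfl⟩ := Ideal.Quotient.mk_surjective x
  rw [← sum_homogeneousComponent f, map_sum]
  exact N.sum_mem fun i _ => key i _ (homogeneousComponent_isHomogeneous i f)

theorem span_isHomogeneous_aux {k : Type*} [Field k] (n : ℕ)
    (Gset : Set (MvPolynomial (Fin (n + 1) ⊕ Fin (n + 1)) k))
    (hbihom : ∀ g ∈ Gset, ∃ d₁ d₂ : ℕ,
      IsWeightedHomogeneous (Sum.elim (fun _ => (1 : ℕ)) (fun _ => 0)) g d₁ ∧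
      IsWeightedHomogeneous (Sum.elim (fun _ => (0 : ℕ)) (fun _ => 1)) g d₂) :
    (Ideal.span Gset).IsHomogeneous (homogeneousSubmodule _ k) := by
  refine Ideal.homogeneous_span _ _ fun g hg => ?_
  obtain ⟨d₁, d₂, h₁, h₂⟩ := hbihom g hg
  refine ⟨d₁ + d₂, ?_⟩
  rw [mem_homogeneousSubmodule]
  intro m hm
  rw [← h₁ hm, ← h₂ hm]
  simp [Finsupp.weight_apply, Finsupp.sum_fintype]

theorem main_aux {k : Type*} [Field k] (n : ℕ)
    (I : Ideal (MvPolynomial (Fin (n + 1) ⊕ Fin (n + 1)) k))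
    (hI : I.IsHomogeneous (homogeneousSubmodule _ k))
    (hdim : (((n + 2 : ℕ) : ℕ∞) : WithBot ℕ∞)
      ≤ ringKrullDim (MvPolynomial (Fin (n + 1) ⊕ Fin (n + 1)) k ⧸ I)) :
    ∃ P : Ideal (MvPolynomial (Fin (n + 1) ⊕ Fin (n + 1)) k), P.IsPrime ∧ I ≤ P ∧
      (∀ i, (X (Sum.inl i) - X (Sum.inr i) : MvPolynomial (Fin (n + 1) ⊕ Fin (n + 1)) k) ∈ P) ∧
      (∃ i, (X (Sum.inl i) : MvPolynomial (Fin (n + 1) ⊕ Fin (n + 1)) k) ∉ P) := by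
  by_contra! hcon
  let z : Fin (n + 1) → MvPolynomial (Fin (n + 1) ⊕ Fin (n + 1)) k :=
    fun i => X (Sum.inl i) - X (Sum.inr i)
  have hz : ∀ i, z i ∈ homogeneousSubmodule (Fin (n + 1) ⊕ Fin (n + 1)) k 1 := fun i =>
    Submodule.sub_mem _ (isHomogeneous_X _ _) (isHomogeneous_X _ _)
  have hrad : idealOfVars (Fin (n + 1) ⊕ Fin (n + 1)) k ≤
      (I ⊔ Ideal.span (Set.range z)).radical := by
    rw [Ideal.radical_eq_sInf]
    refine le_sInf ?_
    rintro P ⟨hP, hprime⟩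
    have hd : ∀ i, z i ∈ P := fun i =>
      hP (Ideal.mem_sup_right (Ideal.subset_span ⟨i, rfl⟩))
    have hx := hcon P hprime (le_sup_left.trans hP) hd
    rw [idealOfVars, Ideal.span_le]
    rintro _ ⟨i | i, rfl⟩
    · exact hx i
    · have := P.sub_mem (hx i) (hd i)
      simpa [z] using this
  obtain ⟨M, hM⟩ := Ideal.exists_pow_le_of_le_radical_of_fg hrad (idealOfVars_fg _ _)
  have h := ringKrullDim_le_of_finite_hom _ (finite_of_pow_le I hI z hz M hM)
  rw [MvPolynomial.ringKrullDim_of_isNoetherianRing, ringKrullDim_eq_zero_of_field] at h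
  have h2 := hdim.trans h
  simp only [Nat.card_eq_fintype_card, Fintype.card_fin, zero_add] at h2
  have h3 : (n + 2 : ℕ) ≤ n + 1 := by exact_mod_cast h2
  omega

end

/-- Let `k` be a field and `V` a closed subscheme of `ℙⁿ_k × ℙⁿ_k`, cut out by an ideal `I`
generated by bihomogeneous polynomials in the bihomogeneous coordinate ring
`k[x₀,…,x_n, y₀,…,y_n]`. The condition `dim V ≥ n` is expressed on the affine cone:
`dim k[x,y]/I ≥ n + 2`. Then `V` meets the diagonal: there is a prime `P ⊇ I`
containing all `xᵢ - yᵢ` and not containing all the `xᵢ` (resp. all the `yᵢ`). -/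
theorem dim_ge_meets_diagonal (k : Type*) [Field k] (n : ℕ)
    (Gset : Set (MvPolynomial (Fin (n + 1) ⊕ Fin (n + 1)) k))
    (hbihom : ∀ g ∈ Gset, ∃ d₁ d₂ : ℕ,
      IsWeightedHomogeneous (Sum.elim (fun _ => (1 : ℕ)) (fun _ => 0)) g d₁ ∧
      IsWeightedHomogeneous (Sum.elim (fun _ => (0 : ℕ)) (fun _ => 1)) g d₂)
    (I : Ideal (MvPolynomial (Fin (n + 1) ⊕ Fin (n + 1)) k)) (hI : I = Ideal.span Gset)
    (hdim : (((n + 2 : ℕ) : ℕ∞) : WithBot ℕ∞)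
      ≤ ringKrullDim (MvPolynomial (Fin (n + 1) ⊕ Fin (n + 1)) k ⧸ I)) :
    ∃ P : Ideal (MvPolynomial (Fin (n + 1) ⊕ Fin (n + 1)) k), P.IsPrime ∧ I ≤ P ∧
      (∀ i, (X (Sum.inl i) - X (Sum.inr i) : MvPolynomial (Fin (n + 1) ⊕ Fin (n + 1)) k) ∈ P) ∧
      (∃ i, (X (Sum.inl i) : MvPolynomial (Fin (n + 1) ⊕ Fin (n + 1)) k) ∉ P) ∧
      (∃ i, (X (Sum.inr i) : MvPolynomial (Fin (n + 1) ⊕ Fin (n + 1)) k) ∉ P) := by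
  subst hI
  obtain ⟨P, hP, hIP, hd, i, hi⟩ :=
    main_aux n (Ideal.span Gset) (span_isHomogeneous_aux n Gset hbihom) hdim
  refine ⟨P, hP, hIP, hd, ⟨i, hi⟩, ⟨i, fun h => hi ?_⟩⟩
  simpa using P.add_mem (hd i) h
end

section
/- Let $X = \mathrm{Spec}\, \mathbb{F}_q[X_1,\ldots,X_n]/(f_1,\ldots,f_\rho)$ be a closed subscheme of $\mathbb{A}^n_{\mathbb{F}_q}$ with $d = \max_i \deg f_i$. Let $B \geq 1$ and let $\mathsf{B} \subseteq \mathbb{R}^n$ be a box (a product of intervals) with each side of length at most $2B$, containing at most one representative of each congruence class modulo $q$ in each coordinate. Then the number of integer points $\mathbf{x} \in \mathsf{B} \cap \mathbb{Z}^n$ with $f_i(\mathbf{x}) \equiv 0 \pmod q$ for all $i$ is $O_{n,\rho,d}(B^{\dim X})$. -/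
open MvPolynomial

/-- Cramer's rule for solvable systems over the fraction field. -/
lemma aux_cramer {A L s t : Type*} [CommRing A] [Field L] [Algebra A L]
    (hinj : Function.Injective (algebraMap A L)) [Fintype s] [Fintype t]
    (M : Matrix s t A) (b : s → A) (v : t → L)
    (h : ∀ i, ∑ k, algebraMap A L (M i k) * v k = algebraMap A L (b i)) :
    ∃ (r : ℕ) (ri : Fin r → s) (ci : Fin r → t) (u : t → A), r ≤ Fintype.card t ∧
      (M.submatrix ri ci).det ≠ 0 ∧
      ∀ i, ∑ k, M i k * u k = (M.submatrix ri ci).det * b i := by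
  classical
  let ML : Matrix s t L := M.map (algebraMap A L)
  obtain ⟨κ, a, ha, hsp, hli⟩ := exists_linearIndependent' L (ML.col)
  have : Finite κ := Finite.of_injective a ha
  have : Fintype κ := Fintype.ofFinite κ
  let N : Matrix s κ L := ML.submatrix id a
  have hNcol : LinearIndependent L N.col := hli
  have hb : (fun i => algebraMap A L (b i)) ∈ Submodule.span L (Set.range (ML.col ∘ a)) := by
    rw [hsp]
    rw [Submodule.mem_span_range_iff_exists_fun]
    refine ⟨v, ?_⟩
    ext i
    rw [← h i]
    simp [ML, Matrix.col, mul_comm]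
  rw [Submodule.mem_span_range_iff_exists_fun] at hb
  obtain ⟨v', hv'⟩ := hb
  have hv'' : ∀ i, ∑ k, algebraMap A L (M i (a k)) * v' k = algebraMap A L (b i) := by
    intro i
    have := congrFun hv' i
    rw [← this]
    simp [ML, Matrix.col, mul_comm]
    rfl
  obtain ⟨κ₂, a₂, ha₂, hsp₂, hli₂⟩ := exists_linearIndependent' L (N.row)
  have : Finite κ₂ := Finite.of_injective a₂ ha₂
  have : Fintype κ₂ := Fintype.ofFinite κ₂
  have hcard : Fintype.card κ₂ = Fintype.card κ := by
    have h1 : Module.finrank L (Submodule.span L (Set.range (N.row ∘ a₂))) = Fintype.card κ₂ :=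
      finrank_span_eq_card hli₂
    rw [hsp₂, ← Matrix.rank_eq_finrank_span_row] at h1
    rw [← h1, Matrix.rank_eq_finrank_span_cols]
    exact finrank_span_eq_card hNcol
  let r := Fintype.card κ
  let e : Fin r ≃ κ := (Fintype.equivFin κ).symm
  let e₂ : Fin r ≃ κ₂ := (Fintype.equivFinOfCardEq hcard).symm
  let Q := M.submatrix (a₂ ∘ e₂) (a ∘ e)
  have hQ : Q.map (algebraMap A L) = N.submatrix (a₂ ∘ e₂) e := rfl
  have hdetL : (Q.map (algebraMap A L)).det ≠ 0 := by
    have : LinearIndependent L (Q.map (algebraMap A L)).row := by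
      have h1 := hli₂.comp e₂ e₂.injective
      have h2 := h1.map' (LinearEquiv.funCongrLeft L L e : (κ → L) ≃ₗ[L] (Fin r → L)).toLinearMap
        (LinearEquiv.ker _)
      exact h2
    rw [Matrix.linearIndependent_rows_iff_isUnit, Matrix.isUnit_iff_isUnit_det] at this
    exact this.ne_zero
  have hdetmap : algebraMap A L Q.det = (Q.map (algebraMap A L)).det := by
    rw [RingHom.map_det]; rfl
  let u' : Fin r → A := Q.adjugate.mulVec (fun i => b (a₂ (e₂ i)))
  have hu' : ∀ i, algebraMap A L (u' i) = algebraMap A L Q.det * v' (e i) := by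
    have hmul : (Q.map (algebraMap A L)).mulVec (v' ∘ e) =
        fun i => algebraMap A L (b (a₂ (e₂ i))) := by
      ext i
      rw [← hv'', ← e.sum_comp]
      rfl
    have h2 : (Q.map (algebraMap A L)).adjugate.mulVec
        (fun i => algebraMap A L (b (a₂ (e₂ i)))) = (Q.map (algebraMap A L)).det • (v' ∘ e) := by
      rw [← hmul, Matrix.mulVec_mulVec, Matrix.adjugate_mul, Matrix.smul_mulVec, Matrix.one_mulVec]
    intro i
    rw [hdetmap]
    have h3 := congrFun h2 i
    simp only [Pi.smul_apply, smul_eq_mul, Function.comp] at h3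
    rw [← h3]
    have h4 : (Q.map (algebraMap A L)).adjugate = Q.adjugate.map (algebraMap A L) :=
      ((algebraMap A L).map_adjugate Q).symm
    rw [h4]
    simp [u', Matrix.mulVec, dotProduct]
  refine ⟨r, a₂ ∘ e₂, a ∘ e, fun k => ∑ i, if a (e i) = k then u' i else 0,
    Fintype.card_le_of_injective a ha, ?_, ?_⟩
  · intro h0
    apply hdetL
    rw [← hdetmap]
    change algebraMap A L (M.submatrix (a₂ ∘ e₂) (a ∘ e)).det = 0
    rw [h0, map_zero]
  · intro i
    apply hinj
    change _ = algebraMap A L (Q.det * b i)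
    have : ∑ k, M i k * (∑ j, if a (e j) = k then u' j else 0) = ∑ j, M i (a (e j)) * u' j := by
      simp_rw [Finset.mul_sum]
      rw [Finset.sum_comm]
      simp
    rw [this, map_sum, map_mul, ← hv'', ← e.sum_comp, Finset.mul_sum]
    refine Finset.sum_congr rfl fun j _ => ?_
    rw [map_mul, hu']
    ring

/-- transcendence degree bounds Krull dimension from below. -/
lemma aux_dim {K L : Type} [Field K] [Field L] [Algebra K L] {n : ℕ}
    (I : Ideal (MvPolynomial (Fin n) K)) (y : Fin n → L) (hI : ∀ p ∈ I, aeval y p = 0)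
    (J : Finset (Fin n)) (hJ : AlgebraicIndependent K (fun j : J => y j)) (m : ℕ)
    (hm : ringKrullDim (MvPolynomial (Fin n) K ⧸ I) = ((m : ℕ∞) : WithBot ℕ∞)) :
    J.card ≤ m := by
  let φ : MvPolynomial (Fin n) K →ₐ[K] L := aeval y
  let A := φ.range
  have : Algebra.FiniteType K A :=
    Algebra.FiniteType.of_surjective φ.rangeRestrict φ.rangeRestrict_surjective
  have h1 : ringKrullDim A ≤ m := by
    have hs := ringKrullDim_le_of_surjective
      (Ideal.Quotient.lift I (φ.rangeRestrict : MvPolynomial (Fin n) K →+* A)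
        (fun p hp => Subtype.ext (hI p hp)))
      (Ideal.Quotient.lift_surjective_of_surjective _ _ φ.rangeRestrict_surjective)
    rw [hm] at hs
    exact hs
  obtain ⟨s, g, ginj, gint⟩ := exists_integral_inj_algHom_of_fg K A
  have h2 : (s : WithBot ℕ∞) ≤ ringKrullDim A := by
    algebraize [g.toRingHom]
    have : FaithfulSMul (MvPolynomial (Fin s) K) A :=
      (faithfulSMul_iff_algebraMap_injective _ _).mpr ginj
    have hd : ringKrullDim (MvPolynomial (Fin s) K) = s := by simp
    obtain ⟨l, hl⟩ := Order.le_krullDim_iff.mp hd.ge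
    obtain ⟨⟨P, hP1, hP2⟩⟩ := Ideal.nonempty_primesOver (S := A) (RelSeries.head l).asIdeal
    obtain ⟨l', hl', -⟩ := Ideal.exists_ltSeries_of_hasGoingUp l P
    exact Order.le_krullDim_iff.mpr ⟨l', hl'.trans hl⟩
  have h3 : (J.card : Cardinal.{0}) ≤ s := by
    have hJ' : AlgebraicIndependent K (fun j : J => (⟨y j, X j.1, by simp [φ]⟩ : A)) :=
      AlgebraicIndependent.of_comp A.val hJ
    have h4 := hJ'.cardinalMk_le_trdeg
    have h5 : Algebra.trdeg K A = s := by
      algebraize [g.toRingHom]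
      have : FaithfulSMul (MvPolynomial (Fin s) K) A :=
        (faithfulSMul_iff_algebraMap_injective _ _).mpr ginj
      rw [← _root_.trdeg_add_eq K (MvPolynomial (Fin s) K) (A := A), _root_.trdeg_eq_zero (R := MvPolynomial (Fin s) K) (A := A)]
      simp
    rw [h5] at h4
    simpa using h4
  have h4 : J.card ≤ s := by exact_mod_cast h3
  have h5 : s ≤ m := by
    have := h2.trans h1
    exact_mod_cast this
  omega

/-- A point of the quotient of a product of algebraically closed fields. -/
lemma aux_quot_algClosed (k : ℕ → Type) [∀ N, Field (k N)] [∀ N, IsAlgClosed (k N)]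
    (M : Ideal (∀ N, k N)) [M.IsMaximal] :
    let : Field ((∀ N, k N) ⧸ M) := Ideal.Quotient.field M
    IsAlgClosed ((∀ N, k N) ⧸ M) := by
  let : Field ((∀ N, k N) ⧸ M) := Ideal.Quotient.field M
  apply IsAlgClosed.of_exists_root
  intro p hp hirr
  have hl : p ∈ Polynomial.lifts (Ideal.Quotient.mk M) := by
    rw [Polynomial.mem_lifts]
    exact Polynomial.map_surjective _ Ideal.Quotient.mk_surjective p
  obtain ⟨P, hP, hdeg, hmon⟩ := Polynomial.lifts_and_natDegree_eq_and_monic hl hp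
  have hroot : ∀ N, ∃ x : k N, Polynomial.eval x (P.map (Pi.evalRingHom k N)) = 0 := by
    intro N
    apply IsAlgClosed.exists_root
    have h1 : (P.map (Pi.evalRingHom k N)).natDegree = P.natDegree := hmon.natDegree_map _
    have h2 : 0 < p.natDegree := hirr.natDegree_pos
    intro h0
    have h3 := Polynomial.natDegree_eq_zero_iff_degree_le_zero.mpr h0.le
    omega
  choose x hx using hroot
  refine ⟨Ideal.Quotient.mk M x, ?_⟩
  have hz : Polynomial.eval x P = 0 := by
    funext N
    have := hx N
    have h2 : x N = Pi.evalRingHom k N x := rfl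
    rw [h2, Polynomial.eval_map_apply] at this
    exact this
  rw [← hP, Polynomial.eval_map_apply, hz, map_zero]

lemma aux_prime_max (k : ℕ → Type) [∀ N, Field (k N)] (M : Ideal (∀ N, k N)) [hM : M.IsPrime] :
    M.IsMaximal := by
  classical
  rw [Ideal.isMaximal_iff]
  refine ⟨fun h => hM.ne_top ((Ideal.eq_top_iff_one _).mpr h), ?_⟩
  intro J x hMJ hxM hxJ
  have h1 : x * (1 - x⁻¹ * x) = 0 := by
    funext N
    by_cases h : x N = 0
    · simp [h]
    · simp [h]
  have h2 : (1 - x⁻¹ * x) ∈ M := by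
    have : x * (1 - x⁻¹ * x) ∈ M := by rw [h1]; exact M.zero_mem
    exact (hM.mem_or_mem this).resolve_left hxM
  have h3 : (1 : ∀ N, k N) = (1 - x⁻¹ * x) + x⁻¹ * x := by ring
  rw [h3]
  exact J.add_mem (hMJ h2) (J.mul_mem_left _ hxJ)

/-- Uniform Nullstellensatz. -/
lemma aux_null (n d : ℕ) (ι : Type) [Fintype ι] : ∃ N : ℕ, ∀ (L : Type) [Field L] [IsAlgClosed L]
    (f : ι → MvPolynomial (Fin n) L), (∀ j, (f j).totalDegree ≤ d) →
    (∀ y : Fin n → L, ∃ j, eval y (f j) ≠ 0) →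
    ∃ g : ι → MvPolynomial (Fin n) L, (∀ j, (g j).totalDegree ≤ N) ∧ ∑ j, g j * f j = 1 := by
  classical
  by_contra hcon
  push Not at hcon
  choose k hk hac f hdeg hnz hno using hcon
  let R := ∀ N, k N
  let F : ι → MvPolynomial (Fin n) R := fun j =>
    ∑ α ∈ Finset.Iic (Finsupp.equivFunOnFinite.symm fun _ : Fin n => d),
      monomial α (fun N => coeff α (f N j))
  have hF : ∀ N j, map (Pi.evalRingHom k N) (F j) = f N j := by
    intro N j
    simp only [F, map_sum, map_monomial]
    conv_rhs => rw [← support_sum_monomial_coeff (f N j)]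
    symm
    apply Finset.sum_subset
    · intro α hα
      rw [Finset.mem_Iic]
      intro i
      have h1 := le_totalDegree hα
      have h2 := hdeg N j
      have h3 : α i ≤ α.sum fun _ e => e := by
        by_cases h : α i = 0
        · omega
        · exact Finset.single_le_sum (f := fun i => α i) (fun _ _ => Nat.zero_le _)
            (Finsupp.mem_support_iff.mpr h)
      simp
      omega
    · intro α _ hα
      rw [notMem_support_iff.mp hα, monomial_zero]
  have htop : Ideal.span (Set.range F) = ⊤ := by
    by_contra hne
    obtain ⟨m, hm, hle⟩ := Ideal.exists_le_maximal _ hne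
    let M : Ideal R := m.comap C
    have : M.IsPrime := Ideal.comap_isPrime C m
    have hMax : M.IsMaximal := aux_prime_max k M
    let : Field (R ⧸ M) := Ideal.Quotient.field M
    have : IsAlgClosed (R ⧸ M) := aux_quot_algClosed k M
    let π : MvPolynomial (Fin n) R →+* MvPolynomial (Fin n) (R ⧸ M) := map (Ideal.Quotient.mk M)
    have hπ : Function.Surjective π := map_surjective _ Ideal.Quotient.mk_surjective
    have hker : RingHom.ker π ≤ m := by
      intro p hp
      have hp' : map (Ideal.Quotient.mk M) p = 0 := hp
      rw [← support_sum_monomial_coeff p]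
      refine Ideal.sum_mem _ fun α _ => ?_
      have h1 : coeff α p ∈ M := by
        rw [← Ideal.Quotient.eq_zero_iff_mem, ← coeff_map, hp', coeff_zero]
      rw [← mul_one (coeff α p), ← C_mul_monomial]
      exact m.mul_mem_right _ h1
    have hmax' : (m.map π).IsMaximal := by
      rcases Ideal.map_eq_top_or_isMaximal_of_surjective π hπ hm with h | h
      · exfalso
        have h2 := Ideal.comap_map_of_surjective π hπ m
        rw [h, Ideal.comap_top] at h2
        have h3 : m = ⊤ := by
          rw [eq_top_iff, h2]
          exact sup_le le_rfl hker
        exact hm.ne_top h3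
      · exact h
    obtain ⟨x, hx⟩ := eq_vanishingIdeal_singleton_of_isMaximal (R ⧸ M) hmax'
    choose y hy using fun i => Ideal.Quotient.mk_surjective (x i)
    have hmem : ∀ j, eval y (F j) ∈ M := by
      intro j
      have h1 : π (F j) ∈ m.map π :=
        Ideal.mem_map_of_mem _ (hle (Ideal.subset_span ⟨j, rfl⟩))
      rw [hx, mem_vanishingIdeal_singleton_iff] at h1
      rw [← Ideal.Quotient.eq_zero_iff_mem, ← h1]
      have h2 : x = Ideal.Quotient.mk M ∘ y := funext fun i => (hy i).symm
      rw [h2]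
      simp only [π, aeval_def, eval₂_map, Algebra.algebraMap_self, RingHom.id_comp]
      rw [← eval₂_comp]
    have hev : ∀ N j, (eval y (F j)) N = eval (fun i => y i N) (f N j) := by
      intro N j
      rw [← hF N j, eval_map]
      exact eval₂_comp (Pi.evalRingHom k N) y (F j)
    choose jj hjj using fun N => hnz N (fun i => y i N)
    apply hMax.ne_top
    rw [Ideal.eq_top_iff_one]
    have : (1 : R) = ∑ j, (fun N => if j = jj N then (eval y (F j) N)⁻¹ else 0) * eval y (F j) := by
      funext N
      rw [Finset.sum_apply, Finset.sum_eq_single (jj N)]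
      · have := hjj N
        rw [← hev] at this
        rw [Pi.mul_apply]
        rw [if_pos rfl, inv_mul_cancel₀ this]
        rfl
      · intro j _ hj
        rw [Pi.mul_apply]
        rw [if_neg hj, zero_mul]
      · simp
    rw [this]
    exact Ideal.sum_mem _ fun j _ => M.mul_mem_left _ (hmem j)
  have h1 : (1 : MvPolynomial (Fin n) R) ∈ Ideal.span (Set.range F) := by rw [htop]; trivial
  rw [Ideal.mem_span_range_iff_exists_fun] at h1
  obtain ⟨G, hG⟩ := h1
  let N := Finset.univ.sup fun j => (G j).totalDegree
  refine hno N (fun j => map (Pi.evalRingHom k N) (G j)) (fun j => ?_) ?_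
  · have h2 : (G j).totalDegree ≤ N :=
      Finset.le_sup (f := fun j => (G j).totalDegree) (Finset.mem_univ j)
    refine le_trans ?_ h2
    exact Finset.sup_mono (support_map_subset _ _)
  · simp_rw [← hF N, ← map_mul, ← map_sum, hG, map_one]

lemma aux_exp_le {σ : Type*} {R : Type*} [CommSemiring R] {p : MvPolynomial σ R} {β : σ →₀ ℕ}
    (hβ : β ∈ p.support) (i : σ) : β i ≤ p.totalDegree := by
  have h1 := le_totalDegree hβ
  refine le_trans ?_ h1
  by_cases h : β i = 0
  · omega
  · exact Finset.single_le_sum (f := fun i => β i) (fun _ _ => Nat.zero_le _)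
      (Finsupp.mem_support_iff.mpr h)

/-- Counting by standard monomials. -/
lemma aux_count {K : Type} [Field K] [Finite K] {n : ℕ} (Z : Finset (Fin n → K))
    (S : Fin n → Finset K) (hZ : ∀ z ∈ Z, ∀ i, z i ∈ S i) (D E m : ℕ)
    (hD : ∀ i, (S i).card ≤ D)
    (hP : ∀ J : Finset (Fin n), m < J.card → ∃ P : MvPolynomial J K, P ≠ 0 ∧ P.totalDegree ≤ E ∧
      ∀ z ∈ Z, eval (fun j : J => z j) P = 0) :
    Z.card ≤ ∑ T ∈ (Finset.univ : Finset (Finset (Fin n))).filter (fun T => T.card ≤ m),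
      D ^ T.card * (E + 1) ^ n := by
  classical
  have := Fintype.ofFinite K
  let mo : MonomialOrder (Fin n) := MonomialOrder.lex
  let Bs : Set (MvPolynomial (Fin n) K) := {Q | Q ≠ 0 ∧ ∀ z ∈ Z, eval z Q = 0}
  -- the standard monomials
  let St : Finset (Fin n → ℕ) :=
    ((Finset.univ : Finset (Finset (Fin n))).filter (fun T => T.card ≤ m)).biUnion fun T =>
      Fintype.piFinset fun i => if i ∈ T then Finset.range D else Finset.range (E + 1)
  have hSt : St.card ≤ ∑ T ∈ (Finset.univ : Finset (Finset (Fin n))).filter (fun T => T.card ≤ m),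
      D ^ T.card * (E + 1) ^ n := by
    refine Finset.card_biUnion_le.trans (Finset.sum_le_sum fun T _ => ?_)
    rw [Fintype.card_piFinset]
    have : ∀ i, (if i ∈ T then Finset.range D else Finset.range (E + 1)).card =
        if i ∈ T then D else E + 1 := by
      intro i; split_ifs <;> simp
    simp_rw [this]
    rw [Finset.prod_ite]
    simp only [Finset.prod_const]
    have h1 : (Finset.univ.filter (fun i => i ∈ T)) = T := by ext; simp
    rw [h1]
    refine Nat.mul_le_mul le_rfl (Nat.pow_le_pow_right (Nat.succ_pos _) ?_)
    exact (Finset.card_le_univ _).trans (by simp)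
  refine le_trans ?_ hSt
  -- key property: standard monomials
  have hkey : ∀ α : Fin n →₀ ℕ, (∀ b ∈ Bs, ¬ mo.degree b ≤ α) → (α : Fin n → ℕ) ∈ St := by
    intro α hα
    have gen : ∀ (Q : MvPolynomial (Fin n) K) (J : Finset (Fin n)) (e : ℕ), Q ≠ 0 →
        (∀ z ∈ Z, eval z Q = 0) → Q.vars ⊆ J → Q.totalDegree ≤ e → ∃ i ∈ J, α i < e := by
      intro Q J e hQ hz hv he
      by_contra hcon
      push Not at hcon
      apply hα Q ⟨hQ, hz⟩
      have hmem : mo.degree Q ∈ Q.support := mo.degree_mem_support hQ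
      intro i
      by_cases hi : i ∈ J
      · exact (aux_exp_le hmem i).trans (he.trans (hcon i hi))
      · have : (mo.degree Q) i = 0 := by
          by_contra h0
          exact hi (hv (mem_vars_iff_mem_support i |>.mpr ⟨_, hmem, Finsupp.mem_support_iff.mpr h0⟩))
        rw [this]; exact Nat.zero_le _
    have hlt : ∀ i, α i < D := by
      intro i
      let Q : MvPolynomial (Fin n) K := ∏ s ∈ S i, (X i - C s)
      have hne : ∀ s : K, (X i - C s : MvPolynomial (Fin n) K) ≠ 0 := by
        intro s h0
        have h1 := congrArg (eval (fun _ => s + 1)) h0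
        simp at h1
      obtain ⟨j, hj, hj'⟩ := gen Q {i} D (Finset.prod_ne_zero_iff.mpr fun s _ => hne s)
        (fun z hz => by
          simp only [Q, eval_prod]
          exact Finset.prod_eq_zero (hZ z hz i) (by simp))
        (by
          refine (vars_prod _).trans ?_
          intro x hx
          rw [Finset.mem_biUnion] at hx
          obtain ⟨s, -, hx⟩ := hx
          have := vars_sub_subset (p := (X i : MvPolynomial (Fin n) K)) (q := C s) hx
          simpa using this)
        (by
          refine (totalDegree_finsetProd _ _).trans ?_
          refine le_trans (Finset.sum_le_card_nsmul _ _ 1 fun s _ => ?_) (by simpa using hD i)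
          refine (totalDegree_sub _ _).trans ?_
          simp)
      rw [Finset.mem_singleton] at hj
      rwa [hj] at hj'
    let T : Finset (Fin n) := Finset.univ.filter fun i => E ≤ α i
    have hT : T.card ≤ m := by
      by_contra hcon
      push Not at hcon
      obtain ⟨P, hP0, hPd, hPz⟩ := hP T hcon
      obtain ⟨i, hi, hi'⟩ := gen (rename Subtype.val P) T E
        (fun h0 => hP0 (rename_injective _ Subtype.val_injective (by rw [h0, map_zero])))
        (fun z hz => by rw [eval_rename]; exact hPz z hz)
        (by
          refine (vars_rename _ _).trans ?_
          intro x hx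
          rw [Finset.mem_image] at hx
          obtain ⟨y, -, rfl⟩ := hx
          exact y.2)
        ((totalDegree_rename_le _ _).trans hPd)
      have := (Finset.mem_filter.mp hi).2
      omega
    rw [Finset.mem_biUnion]
    refine ⟨T, by simpa using hT, ?_⟩
    rw [Fintype.mem_piFinset]
    intro i
    by_cases hi : i ∈ T
    · simpa [hi] using hlt i
    · have : ¬ E ≤ α i := by simpa [T] using hi
      rw [if_neg hi, Finset.mem_range]; omega
  -- the evaluation map is surjective from the span of standard monomials
  let Ψ : (St → K) →ₗ[K] (Z → K) :=
    { toFun := fun c z => ∑ α : St, c α * ∏ i, (z.1 i) ^ (α.1 i)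
      map_add' := by intro c c'; ext z; simp [add_mul, Finset.sum_add_distrib]
      map_smul' := by intro c c'; ext z; simp [Finset.mul_sum, mul_assoc] }
  have hsurj : Function.Surjective Ψ := by
    intro φ
    have htop := map_restrict_dom_evalₗ K (Fin n)
    have hmem : (fun z : Fin n → K => if h : z ∈ Z then φ ⟨z, h⟩ else 0) ∈
        (⊤ : Submodule K ((Fin n → K) → K)) := trivial
    rw [← htop] at hmem
    obtain ⟨p, -, hp⟩ := hmem
    obtain ⟨g, r, hpr, -, hr⟩ := mo.div_set (B := Bs)
      (fun b hb => (mo.leadingCoeff_ne_zero_iff.mpr hb.1).isUnit) p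
    refine ⟨fun α => coeff (Finsupp.equivFunOnFinite.symm α.1) r, ?_⟩
    ext z
    have h1 : eval z.1 p = φ z := by
      have := congrFun hp z.1
      rw [evalₗ_apply] at this
      rw [this]; simp
    have h2 : eval z.1 p = eval z.1 r := by
      rw [hpr, map_add, Finsupp.linearCombination_apply, Finsupp.sum, map_sum,
        Finset.sum_eq_zero, zero_add]
      intro b _
      rw [smul_eq_mul, map_mul, b.2.2 z.1 z.2, mul_zero]
    rw [← h1, h2, eval_eq']
    change ∑ α : St, coeff (Finsupp.equivFunOnFinite.symm α.1) r * ∏ i, (z.1 i) ^ (α.1 i) = _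
    rw [Finset.sum_coe_sort St (fun α => coeff (Finsupp.equivFunOnFinite.symm α) r *
      ∏ i, (z.1 i) ^ (α i))]
    symm
    have hinj : Set.InjOn (fun α : Fin n →₀ ℕ => (α : Fin n → ℕ)) r.support :=
      fun a _ b _ h => DFunLike.coe_injective h
    have himg : r.support.image (fun α : Fin n →₀ ℕ => (α : Fin n → ℕ)) ⊆ St := by
      intro a ha
      obtain ⟨α, hα, rfl⟩ := Finset.mem_image.mp ha
      exact hkey α (hr α hα)
    rw [← Finset.sum_subset himg, Finset.sum_image hinj]
    · refine Finset.sum_congr rfl fun α _ => ?_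
      congr 2
      ext i
      simp
    · intro a _ ha
      have : coeff (Finsupp.equivFunOnFinite.symm a) r = 0 := by
        by_contra h0
        apply ha
        exact Finset.mem_image.mpr ⟨Finsupp.equivFunOnFinite.symm a, mem_support_iff.mpr h0, by simp⟩
      rw [this, zero_mul]
  have := LinearMap.finrank_le_finrank_of_surjective hsurj
  simpa using this

/-- Bounded-degree elimination. -/
lemma aux_elim (n ρ d : ℕ) : ∃ E : ℕ, ∀ (K : Type) [Field K]
    (f : Fin ρ → MvPolynomial (Fin n) K), (∀ j, (f j).totalDegree ≤ d) → ∀ m : ℕ,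
    ringKrullDim (MvPolynomial (Fin n) K ⧸ Ideal.span (Set.range f)) = ((m : ℕ∞) : WithBot ℕ∞) →
    ∀ J : Finset (Fin n), m < J.card → ∃ P : MvPolynomial J K, P ≠ 0 ∧ P.totalDegree ≤ E ∧
      ∀ z : Fin n → K, (∀ j, eval z (f j) = 0) → eval (fun j : J => z j) P = 0 := by
  classical
  obtain ⟨N, hN⟩ := aux_null n (max d 1) (Fin ρ ⊕ Fin n)
  let Ex : Finset (Fin n →₀ ℕ) := Finset.Iic (Finsupp.equivFunOnFinite.symm fun _ : Fin n => N)
  refine ⟨Fintype.card ((Fin ρ ⊕ Fin n) × Ex), ?_⟩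
  intro K _ f hdeg m hm J hJ
  let A := MvPolynomial J K
  let L := AlgebraicClosure (FractionRing A)
  have hinj : Function.Injective (algebraMap A L) := by
    rw [IsScalarTower.algebraMap_eq A (FractionRing A) L]
    exact (algebraMap (FractionRing A) L).injective.comp (IsFractionRing.injective A _)
  let G : Fin ρ ⊕ Fin n → MvPolynomial (Fin n) A := Sum.elim (fun j => map C (f j))
    (fun i => if h : i ∈ J then X i - C (X ⟨i, h⟩) else 0)
  have hGdeg : ∀ j, (G j).totalDegree ≤ max d 1 := by
    rintro (j | i)
    · exact (Finset.sup_mono (support_map_subset _ _)).trans ((hdeg j).trans (le_max_left _ _))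
    · simp only [G, Sum.elim_inr]
      split_ifs with h
      · refine (totalDegree_sub _ _).trans ?_
        simp
      · simp
  have hGcoeff : ∀ j α, (coeff α (G j)).totalDegree ≤ 1 := by
    rintro (j | i) α
    · simp only [G, Sum.elim_inl, coeff_map]
      exact (totalDegree_C _).le.trans zero_le_one
    · simp only [G, Sum.elim_inr]
      split_ifs with h
      · rw [coeff_sub, coeff_X, coeff_C]
        refine (totalDegree_sub _ _).trans ?_
        refine max_le ?_ ?_
        · split_ifs <;> simp
        · split_ifs <;> simp
      · simp
  obtain ⟨g, hg, hsum⟩ := hN L (fun j => map (algebraMap A L) (G j))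
    (fun j => (Finset.sup_mono (support_map_subset _ _)).trans (hGdeg j)) (by
      intro y
      by_contra hcon
      push Not at hcon
      have hyf : ∀ j, aeval y (f j) = 0 := by
        intro j
        have h1 := hcon (Sum.inl j)
        simp only [G, Sum.elim_inl, eval_map, eval₂_map] at h1
        rw [aeval_def, ← h1]
        rfl
      have hyJ : ∀ j : J, y j = algebraMap A L (X j) := by
        intro j
        have h1 := hcon (Sum.inr j.1)
        simp only [G, Sum.elim_inr, j.2, dif_pos] at h1
        simp only [map_sub, map_X, map_C, eval_X, eval_C] at h1
        exact sub_eq_zero.mp h1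
      have hind : AlgebraicIndependent K (fun j : J => y j) := by
        have h1 : AlgebraicIndependent K (X : J → A) := algebraicIndependent_X J K
        have h2 := h1.map' (f := IsScalarTower.toAlgHom K A L) hinj
        have h3 : (fun j : J => y j) = (IsScalarTower.toAlgHom K A L) ∘ (X : J → A) :=
          funext hyJ
        rw [h3]; exact h2
      have := aux_dim (Ideal.span (Set.range f)) y (by
        intro p hp
        have hle : Ideal.span (Set.range f) ≤ RingHom.ker (aeval y : _ →ₐ[K] L) := by
          rw [Ideal.span_le]
          rintro _ ⟨j, rfl⟩
          exact hyf j
        exact hle hp) J hind m hm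
      omega)
  let col : (Fin ρ ⊕ Fin n) × Ex → MvPolynomial (Fin n) A := fun k => monomial k.2.1 1 * G k.1
  let s : Finset (Fin n →₀ ℕ) := insert 0 (Finset.univ.biUnion fun k => (col k).support)
  let M : Matrix s ((Fin ρ ⊕ Fin n) × Ex) A := fun α k => coeff α.1 (col k)
  obtain ⟨r, ri, ci, u, hr, hdet, hu⟩ := aux_cramer hinj M (fun α => coeff α.1 1)
    (fun k => coeff k.2.1 (g k.1)) (by
      intro α
      rw [← coeff_map, map_one, ← hsum, coeff_sum, Fintype.sum_prod_type]
      refine Finset.sum_congr rfl fun j _ => ?_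
      have hgj : g j = ∑ β : Ex, monomial β.1 (coeff β.1 (g j)) := by
        rw [Finset.sum_coe_sort Ex (fun β => monomial β (coeff β (g j)))]
        conv_lhs => rw [← support_sum_monomial_coeff (g j)]
        refine Finset.sum_subset ?_ ?_
        · intro β hβ
          rw [Finset.mem_Iic]
          intro i
          exact (aux_exp_le hβ i).trans (hg j)
        · intro β _ hβ
          rw [notMem_support_iff.mp hβ, monomial_zero]
      conv_rhs => rw [hgj]
      rw [Finset.sum_mul, coeff_sum]
      refine Finset.sum_congr rfl fun β _ => ?_
      simp only [M, col]
      rw [← coeff_map, map_mul, map_monomial, map_one, mul_comm, ← coeff_C_mul, ← mul_assoc,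
        C_mul_monomial, mul_one])
  let P := (M.submatrix ri ci).det
  have hPsum : ∑ k, C (u k) * col k = C P := by
    ext1 α
    rw [coeff_sum]
    simp_rw [coeff_C_mul]
    by_cases hα : α ∈ s
    · have := hu ⟨α, hα⟩
      rw [← mul_one (C P), coeff_C_mul, ← this]
      refine Finset.sum_congr rfl fun k _ => ?_
      rw [mul_comm]
    · have h0 : α ≠ 0 := fun h => hα (by rw [h]; exact Finset.mem_insert_self _ _)
      rw [coeff_C, if_neg h0.symm]
      refine Finset.sum_eq_zero fun k _ => ?_
      have : coeff α (col k) = 0 := by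
        by_contra hne
        exact hα (Finset.mem_insert_of_mem (Finset.mem_biUnion.mpr
          ⟨k, Finset.mem_univ _, mem_support_iff.mpr hne⟩))
      rw [this, mul_zero]
  refine ⟨P, hdet, ?_, ?_⟩
  · have hM : ∀ α k, (M α k).totalDegree ≤ 1 := by
      intro α k
      simp only [M, col, coeff_monomial_mul']
      split_ifs
      · rw [one_mul]; exact hGcoeff _ _
      · simp
    refine le_trans ?_ hr
    simp only [P, Matrix.det_apply]
    refine totalDegree_finsetSum_le fun σ _ => ?_
    refine (totalDegree_smul_le _ _).trans ?_
    refine (totalDegree_finsetProd _ _).trans ?_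
    refine le_trans (Finset.sum_le_card_nsmul _ _ 1 fun i _ => hM _ _) (by simp)
  · intro z hz
    let ev : A →+* K := eval (fun j : J => z j)
    have h1 := congrArg (eval₂ ev z) hPsum
    rw [eval₂_C] at h1
    change ev P = 0
    rw [← h1, eval₂_sum]
    refine Finset.sum_eq_zero fun k _ => ?_
    have hG0 : eval₂ ev z (G k.1) = 0 := by
      rcases k.1 with j | i
      · simp only [G, Sum.elim_inl, eval₂_map]
        rw [← hz j]
        have : ev.comp C = RingHom.id K := RingHom.ext fun x => eval_C x
        rw [this]; rfl
      · simp only [G, Sum.elim_inr]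
        split_ifs with h
        · rw [eval₂_sub, eval₂_X, eval₂_C]
          have : ev (X ⟨i, h⟩) = z i := eval_X _
          rw [this, sub_self]
        · simp
    simp only [col, eval₂_mul, hG0, mul_zero]

theorem trivial_count_box_points (n ρ d : ℕ) :
    ∃ C : ℝ, 0 < C ∧
      ∀ (q : ℕ), q.Prime →
      ∀ (f : Fin ρ → MvPolynomial (Fin n) (ZMod q)),
        (∀ j, (f j).totalDegree ≤ d) →
      ∀ (m : ℕ),
        ringKrullDim (MvPolynomial (Fin n) (ZMod q) ⧸ Ideal.span (Set.range f))
          = ((m : ℕ∞) : WithBot ℕ∞) →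
      ∀ (B : ℝ), 1 ≤ B →
      ∀ (a w : Fin n → ℝ), (∀ i, 0 ≤ w i ∧ w i ≤ 2 * B) →
        (∀ i, ∀ x y : ℤ, a i ≤ (x : ℝ) → (x : ℝ) ≤ a i + w i → a i ≤ (y : ℝ) →
          (y : ℝ) ≤ a i + w i → ((x : ZMod q) = (y : ZMod q)) → x = y) →
        ((Set.ncard {x : Fin n → ℤ | (∀ i, a i ≤ (x i : ℝ) ∧ (x i : ℝ) ≤ a i + w i) ∧
            ∀ j, eval (fun i => ((x i : ℤ) : ZMod q)) (f j) = 0} : ℕ) : ℝ)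
          ≤ C * B ^ m := by
  classical
  obtain ⟨E, hE⟩ := aux_elim n ρ d
  refine ⟨2 ^ n * (3 ^ n * (E + 1) ^ n), by positivity, ?_⟩
  intro q hq f hdeg m hm B hB a w hw hinj
  have : Fact q.Prime := ⟨hq⟩
  have hB0 : (0 : ℝ) < B := by linarith
  let Zs : Set (Fin n → ℤ) := {x | (∀ i, a i ≤ (x i : ℝ) ∧ (x i : ℝ) ≤ a i + w i) ∧
            ∀ j, eval (fun i => ((x i : ℤ) : ZMod q)) (f j) = 0}
  let I : Fin n → Finset ℤ := fun i => Finset.Icc ⌈a i⌉ ⌊a i + w i⌋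
  let D : ℕ := ⌊2 * B⌋₊ + 1
  have hI : ∀ i, (I i).card ≤ D := by
    intro i
    simp only [I, Int.card_Icc, D]
    have h1 : (⌊a i + w i⌋ : ℝ) ≤ a i + w i := Int.floor_le _
    have h2 : a i ≤ ⌈a i⌉ := Int.le_ceil _
    have h3 : ⌊a i + w i⌋ - ⌈a i⌉ ≤ ⌊2 * B⌋ := by
      rw [Int.le_floor]
      push_cast
      linarith [(hw i).2]
    have h4 : ((⌊2 * B⌋₊ : ℕ) : ℤ) = ⌊2 * B⌋ := Int.natCast_floor_eq_floor (by positivity)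
    omega
  have hD3 : (D : ℝ) ≤ 3 * B := by
    have := Nat.floor_le (show 0 ≤ 2 * B by positivity)
    simp only [D]
    push_cast
    linarith
  let red : (Fin n → ℤ) → (Fin n → ZMod q) := fun x i => (x i : ZMod q)
  have hredinj : Set.InjOn red Zs := by
    intro x hx y hy hxy
    funext i
    exact hinj i _ _ (hx.1 i).1 (hx.1 i).2 (hy.1 i).1 (hy.1 i).2 (congrFun hxy i)
  let Z : Finset (Fin n → ZMod q) := (red '' Zs).toFinset
  have hcard : Set.ncard Zs = Z.card := by
    rw [← hredinj.ncard_image, Set.ncard_eq_toFinset_card']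
  have hcount := aux_count Z (fun i => (I i).image (fun x : ℤ => (x : ZMod q)))
    (by
      intro z hz i
      obtain ⟨x, hx, rfl⟩ := Set.mem_toFinset.mp hz
      refine Finset.mem_image_of_mem _ ?_
      rw [Finset.mem_Icc, Int.ceil_le, Int.le_floor]
      exact hx.1 i) D E m (fun i => Finset.card_image_le.trans (hI i))
    (by
      intro J hJ
      obtain ⟨P, hP0, hPd, hPz⟩ := hE (ZMod q) f hdeg m hm J hJ
      refine ⟨P, hP0, hPd, fun z hz => hPz z ?_⟩
      obtain ⟨x, hx, rfl⟩ := Set.mem_toFinset.mp hz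
      exact hx.2)
  change ((Set.ncard Zs : ℕ) : ℝ) ≤ _
  rw [hcard]
  have hcount' : (Z.card : ℝ) ≤
      ∑ T ∈ (Finset.univ : Finset (Finset (Fin n))).filter (fun T => T.card ≤ m),
        (D : ℝ) ^ T.card * ((E : ℝ) + 1) ^ n := by
    exact_mod_cast hcount
  refine hcount'.trans ?_
  have hterm : ∀ T ∈ (Finset.univ : Finset (Finset (Fin n))).filter (fun T => T.card ≤ m),
      (D : ℝ) ^ T.card * ((E : ℝ) + 1) ^ n ≤ 3 ^ n * B ^ m * ((E : ℝ) + 1) ^ n := by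
    intro T hT
    have hTm : T.card ≤ m := (Finset.mem_filter.mp hT).2
    have hTn : T.card ≤ n := by simpa using Finset.card_le_univ T
    gcongr
    calc (D : ℝ) ^ T.card ≤ (3 * B) ^ T.card := by gcongr
      _ = 3 ^ T.card * B ^ T.card := mul_pow _ _ _
      _ ≤ 3 ^ n * B ^ m := by
        gcongr
        · norm_num
  refine (Finset.sum_le_card_nsmul _ _ _ hterm).trans ?_
  have hc : (((Finset.univ : Finset (Finset (Fin n))).filter (fun T => T.card ≤ m)).card : ℝ)
      ≤ 2 ^ n := by
    have h1 := Finset.card_filter_le (Finset.univ : Finset (Finset (Fin n))) (fun T => T.card ≤ m)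
    rw [Finset.card_univ, Fintype.card_finset, Fintype.card_fin] at h1
    exact_mod_cast h1
  rw [nsmul_eq_mul]
  calc _ ≤ (2 : ℝ) ^ n * (3 ^ n * B ^ m * ((E : ℝ) + 1) ^ n) := by gcongr
    _ = _ := by ring
end

section
/- Let $X$ be a complete intersection in $\mathbb{P}^n_k$ over an algebraically closed field $k$, nonempty, with $\dim\mathrm{Sing}\, X = s$. Then there exists a hyperplane $H \subseteq \mathbb{P}^n_k$ such that $\dim(X \cap H) = \dim X - 1$ and $\dim\mathrm{Sing}(X \cap H) < \max(s, 0)$. -/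
open MvPolynomial

/-- The integer Krull dimension of a ring, with `dim 0 = -1` (`⊥ ↦ -1`). -/
noncomputable def wbToInt : WithBot ℕ∞ → ℤ :=
  WithBot.recBotCoe (-1) fun e : ℕ∞ => (e.toNat : ℤ)

/-- The dimension of the projective scheme attached to a homogeneous ideal, via the Krull
dimension of its affine cone (`dim Proj = dim cone - 1`, empty scheme has dimension `-1`). -/
noncomputable def projDimOf (a : WithBot ℕ∞) : ℤ := max (wbToInt a - 1) (-1)


theorem bt_chain_length {R : Type*} [CommRing R] (I : Ideal R) (N : ℕ)
    (h : ringKrullDim (R ⧸ I) ≤ N) (l : LTSeries (PrimeSpectrum R))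
    (hl : I ≤ l.head.asIdeal) : l.length ≤ N := by
  rw [ringKrullDim_quotient] at h
  let l' : LTSeries (PrimeSpectrum.zeroLocus (R := R) I) :=
    LTSeries.mk l.length (fun i => ⟨l i, fun x hx => LTSeries.head_le l i (hl hx)⟩)
      (fun i j hij => l.strictMono hij)
  have := (Order.LTSeries.length_le_krullDim l').trans h
  exact_mod_cast this

theorem bt_dim_le {R : Type*} [CommRing R] (K : Ideal R) (N : ℕ)
    (h : ∀ l : LTSeries (PrimeSpectrum R), K ≤ l.head.asIdeal → l.length ≤ N) :
    ringKrullDim (R ⧸ K) ≤ N := by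
  rw [ringKrullDim_quotient]
  refine iSup_le fun l => ?_
  have := h (l.map Subtype.val (fun _ _ h => h)) l.head.2
  exact_mod_cast this

theorem bt_length_max {R : Type*} [CommRing R] (l : LTSeries (PrimeSpectrum R))
    (h : l.head.asIdeal.IsMaximal) : l.length = 0 := by
  by_contra hne
  have h1 : l.head < l ⟨1, by omega⟩ := l.strictMono (by
    rw [Fin.lt_def]; simp)
  have h2 : l.head.asIdeal < (l ⟨1, by omega⟩).asIdeal := h1
  exact (l ⟨1, by omega⟩).isPrime.ne_top (h.1.2 _ h2)

/-- Cutting by an element avoiding the non-maximal minimal primes drops the dimension. -/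
theorem bt_cut {R : Type*} [CommRing R] (I : Ideal R) (x : R) (N : ℕ)
    (hx : ∀ P ∈ I.minimalPrimes, x ∉ P ∨ P.IsMaximal)
    (h : ringKrullDim (R ⧸ I) ≤ (N + 1 : ℕ)) :
    ringKrullDim (R ⧸ (I ⊔ Ideal.span {x})) ≤ N := by
  refine bt_dim_le _ _ fun l hl => ?_
  have hxl : x ∈ l.head.asIdeal :=
    hl (Ideal.mem_sup_right (Ideal.mem_span_singleton_self x))
  obtain ⟨p, hp, hp'⟩ := Ideal.exists_minimalPrimes_le (le_sup_left.trans hl)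
  rcases hx p hp with hxp | hmax
  · let p' : PrimeSpectrum R := ⟨p, hp.1.1⟩
    have hlt : p' < l.head := lt_of_le_of_ne hp' fun h => hxp (by
      have : p = l.head.asIdeal := congrArg PrimeSpectrum.asIdeal h
      rw [this]; exact hxl)
    have := bt_chain_length I (N + 1) h (l.cons p' hlt) hp.1.2
    simpa using this
  · have : p = l.head.asIdeal := hmax.eq_of_le l.head.isPrime.ne_top hp'
    rw [bt_length_max l (this ▸ hmax)]
    exact Nat.zero_le _

theorem bt_compare {R : Type*} [CommRing R] (K K' : Ideal R) (N : ℕ)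
    (hK : ∀ q : Ideal R, q.IsPrime → K ≤ q → K' ≤ q ∨ q.IsMaximal)
    (h : ringKrullDim (R ⧸ K') ≤ N) : ringKrullDim (R ⧸ K) ≤ N := by
  refine bt_dim_le _ _ fun l hl => ?_
  rcases hK _ l.head.isPrime hl with h1 | h1
  · exact bt_chain_length K' N h l h1
  · rw [bt_length_max l h1]; exact Nat.zero_le _

theorem bt_dim_of_integral {A B : Type*} [CommRing A] [CommRing B] (g : A →+* B)
    (hg : Function.Injective g) (hi : g.IsIntegral) : ringKrullDim A ≤ ringKrullDim B := by
  let _ := g.toAlgebra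
  have : Algebra.IsIntegral A B := ⟨hi⟩
  refine iSup_le fun l => ?_
  have : l.head.asIdeal.IsPrime := l.head.isPrime
  obtain ⟨P, -, hP, hc⟩ := Ideal.exists_ideal_over_prime_of_isIntegral (R := A) (S := B) l.head.asIdeal ⊥ (by
    intro x hx
    have : g x = 0 := hx
    rw [(map_eq_zero_iff g hg).1 this]; exact zero_mem _)
  have : P.LiesOver l.head.asIdeal := ⟨hc.symm⟩
  obtain ⟨L, hL, -⟩ := Ideal.exists_ltSeries_of_hasGoingUp l P
  rw [← hL]
  exact Order.LTSeries.length_le_krullDim L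

/-- height of the origin -/
theorem bt_height (k : Type*) [Field k] (m : ℕ) :
    (m : ℕ∞) ≤ (vanishingIdeal k {(0 : Fin m → k)}).height := by
  let φ (i : ℕ) : MvPolynomial (Fin m) k →ₐ[k] MvPolynomial (Fin m) k :=
    aeval (fun j : Fin m => if j.1 < i then 0 else X j)
  have hφ : ∀ i i', i ≤ i' → (φ i').comp (φ i) = φ i' := by
    intro i i' h
    ext j : 1
    simp only [φ, AlgHom.comp_apply, aeval_X]
    split_ifs with h1 h2
    · simp
    · omega
    · simp [*]
    · simp [*]
  have key : ∀ i i', i ≤ i' → RingHom.ker (φ i) ≤ RingHom.ker (φ i') := by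
    intro i i' h x hx
    rw [RingHom.mem_ker] at hx ⊢
    rw [← hφ i i' h, AlgHom.comp_apply, hx, map_zero]
  let l : LTSeries (PrimeSpectrum (MvPolynomial (Fin m) k)) :=
    LTSeries.mk m (fun i => ⟨RingHom.ker (φ i), RingHom.ker_isPrime _⟩) (by
      intro i j hij
      refine lt_of_le_of_ne (key _ _ (le_of_lt hij)) ?_
      intro h
      have h' : RingHom.ker (φ i) = RingHom.ker (φ j) := congrArg PrimeSpectrum.asIdeal h
      have hi : i.1 < m := by have := j.2; have : i.1 < j.1 := hij; omega
      have : (X ⟨i, hi⟩ : MvPolynomial (Fin m) k) ∈ RingHom.ker (φ j) := by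
        rw [RingHom.mem_ker]; simp only [φ, aeval_X]; exact if_pos hij
      rw [← h', RingHom.mem_ker] at this
      simp [φ] at this)
  have hp : (vanishingIdeal k {(0 : Fin m → k)}).IsPrime := inferInstance
  have h0 := PrimeSpectrum.height_eq_orderHeight
    (⟨vanishingIdeal k {(0 : Fin m → k)}, hp⟩ : PrimeSpectrum (MvPolynomial (Fin m) k))
  change (vanishingIdeal k {(0 : Fin m → k)}).height = _ at h0
  rw [h0]
  refine Order.length_le_height (p := l) ?_
  have hlast : l.last = ⟨RingHom.ker (φ m), RingHom.ker_isPrime _⟩ := rfl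
  rw [hlast]
  intro x hx
  change x ∈ RingHom.ker (φ m) at hx
  change x ∈ vanishingIdeal k {(0 : Fin m → k)}
  rw [RingHom.mem_ker] at hx
  rw [mem_vanishingIdeal_singleton_iff]
  have hc : (aeval (0 : Fin m → k) : MvPolynomial (Fin m) k →ₐ[k] k).comp (φ m) = aeval 0 := by
    ext j : 1
    simp [φ]
  rw [← hc, AlgHom.comp_apply, hx, map_zero]

/-- too many variables cannot inject in a small algebra -/
theorem bt_not_inj (k : Type*) [Field k] {B : Type*} [CommRing B] [Algebra k B]
    [Algebra.FiniteType k B] (m : ℕ) (hB : ringKrullDim B < m)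
    (f : MvPolynomial (Fin m) k →ₐ[k] B) : ∃ g, g ≠ 0 ∧ f g = 0 := by
  by_contra! hcon
  have hf : Function.Injective f := by
    rw [injective_iff_map_eq_zero]
    intro a ha; by_contra h; exact hcon a h ha
  obtain ⟨Q, hQ, hc⟩ := Ideal.exists_comap_eq_of_mem_minimalPrimes_of_injective (f := f.toRingHom) hf ⊥ (by
    rw [IsDomain.minimalPrimes_eq_singleton_bot]; rfl)
  have hinj : Function.Injective ((Ideal.Quotient.mkₐ k Q).comp f) := by
    rw [injective_iff_map_eq_zero]
    intro a ha
    have : a ∈ Q.comap f.toRingHom := Ideal.mem_comap.2 (Ideal.Quotient.eq_zero_iff_mem.1 ha)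
    rw [hc] at this
    simpa using this
  obtain ⟨s, g, hg, hgi⟩ := exists_integral_inj_algHom_of_fg k (B ⧸ Q)
  have hd := bt_dim_of_integral g.toRingHom hg hgi
  rw [MvPolynomial.ringKrullDim_of_isNoetherianRing, ringKrullDim_eq_zero_of_field] at hd
  have h1 : Algebra.IsAlgebraic (Algebra.adjoin k (Set.range fun i => g (X i))) (B ⧸ Q) := by
    have hr : ∀ x, g x ∈ Algebra.adjoin k (Set.range fun i => g (X i)) := by
      intro x
      have : g.range = Algebra.adjoin k (Set.range fun i => g (X i)) := by
        rw [← Algebra.map_top, ← MvPolynomial.adjoin_range_X, AlgHom.map_adjoin, ← Set.range_comp]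
        rfl
      rw [← this]; exact ⟨x, rfl⟩
    have hIntegral : (algebraMap (Algebra.adjoin k (Set.range fun i => g (X i))) (B ⧸ Q)).IsIntegral := by
      refine RingHom.IsIntegral.tower_top (g.codRestrict _ hr).toRingHom _ ?_
      exact hgi
    exact ⟨fun b => IsIntegral.isAlgebraic (hIntegral b)⟩
  have h2 := Algebra.IsAlgebraic.trdeg_le_cardinalMk k (Set.range fun i => g (X i))
  have h3 := lift_trdeg_le_of_injective _ hinj
  have h5 : (s : WithBot ℕ∞) < m := by
    refine lt_of_le_of_lt ?_ hB
    refine le_trans ?_ (ringKrullDim_quotient_le Q)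
    simpa using hd
  have h6 : s < m := by exact_mod_cast h5
  have h7 : Cardinal.mk (Set.range fun i => g (X i)) ≤ s := by
    have := Cardinal.mk_range_le_lift (f := fun i : Fin s => g (X i))
    simpa using this
  rw [MvPolynomial.trdeg_of_isDomain] at h3
  have h8 := Cardinal.lift_le.2 (h2.trans h7)
  have h9 := h3.trans h8
  simp at h9
  omega

theorem bt_minor {k : Type*} [Field k] {m n : ℕ} (v : Fin m → Fin n → k)
    (hv : LinearIndependent k v) :
    ∃ sel : Fin m → Fin n, (Matrix.of fun i t : Fin m => v i (sel t)).det ≠ 0 := by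
  have hr : (Matrix.of v).rank = m := by
    have := LinearIndependent.rank_matrix (M := Matrix.of v) hv
    simpa using this
  rw [Matrix.rank_eq_finrank_span_cols] at hr
  obtain ⟨κ, a, ha, hsp, hli⟩ := exists_linearIndependent' k (Matrix.of v).col
  have : Finite κ := Finite.of_injective a ha
  have := Fintype.ofFinite κ
  have hc : Fintype.card κ = m := by
    rw [← hr, ← hsp, finrank_span_eq_card hli]
  let e : Fin m ≃ κ := (Fintype.equivFinOfCardEq hc).symm
  refine ⟨a ∘ e, ?_⟩
  have hli2 : LinearIndependent k (Matrix.of fun i t : Fin m => v i ((a ∘ e) t)).col :=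
    hli.comp e e.injective
  rw [Matrix.linearIndependent_cols_iff_isUnit, Matrix.isUnit_iff_isUnit_det] at hli2
  exact hli2.ne_zero

theorem bt_indep {k : Type*} [Field k] {m n : ℕ} (v : Fin m → Fin n → k)
    (sel : Fin m → Fin n) (h : (Matrix.of fun i t : Fin m => v i (sel t)).det ≠ 0) :
    LinearIndependent k v := by
  have := Matrix.linearIndependent_rows_of_det_ne_zero h
  exact LinearIndependent.of_comp (LinearMap.funLeft k k sel) this

/-- A set of parameters contained in a proper hypersurface. -/
def BtSmall {k : Type*} [Field k] {m : ℕ} (Z : Set (Fin m → k)) : Prop :=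
  ∃ g : MvPolynomial (Fin m) k, g ≠ 0 ∧ ∀ c ∈ Z, eval c g = 0

theorem BtSmall.iUnion {k : Type*} [Field k] {m : ℕ} {ι : Type*} [Finite ι]
    {Z : ι → Set (Fin m → k)} (h : ∀ i, BtSmall (Z i)) : BtSmall (⋃ i, Z i) := by
  have := Fintype.ofFinite ι
  choose g hg hz using h
  refine ⟨∏ i, g i, Finset.prod_ne_zero_iff.2 fun i _ => hg i, ?_⟩
  intro c hc
  obtain ⟨i, hi⟩ := Set.mem_iUnion.1 hc
  rw [map_prod]
  exact Finset.prod_eq_zero (Finset.mem_univ i) (hz i c hi)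

theorem BtSmall.union {k : Type*} [Field k] {m : ℕ}
    {Z Z' : Set (Fin m → k)} (h : BtSmall Z) (h' : BtSmall Z') : BtSmall (Z ∪ Z') := by
  obtain ⟨g, hg, hz⟩ := h
  obtain ⟨g', hg', hz'⟩ := h'
  refine ⟨g * g', mul_ne_zero hg hg', ?_⟩
  rintro c (hc | hc)
  · simp [hz c hc]
  · simp [hz' c hc]

theorem BtSmall.exists_notMem {k : Type*} [Field k] [Infinite k] {m : ℕ}
    {Z : Set (Fin m → k)} (h : BtSmall Z) : ∃ c, c ∉ Z := by
  by_contra! hc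
  obtain ⟨g, hg, hz⟩ := h
  exact hg (MvPolynomial.funext fun c => by rw [hz c (hc c), map_zero])

theorem bt_small_zero {k : Type*} [Field k] {m : ℕ} (j : Fin m) :
    BtSmall ({0} : Set (Fin m → k)) :=
  ⟨X j, X_ne_zero j, by rintro c rfl; simp⟩

theorem bt_small_prime {k : Type*} [Field k] {m : ℕ} (P : Ideal (MvPolynomial (Fin m) k))
    (j : Fin m) (hj : X j ∉ P) :
    BtSmall {c : Fin m → k | ∑ i, C (c i) * X i ∈ P} := by
  let W : Submodule k (Fin m → k) :=
    { carrier := {c : Fin m → k | ∑ i, C (c i) * X i ∈ P}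
      zero_mem' := by simp
      add_mem' := by
        intro a b ha hb
        have := P.add_mem ha hb
        rw [← Finset.sum_add_distrib] at this
        simpa [add_mul] using this
      smul_mem' := by
        intro t a ha
        have := P.mul_mem_left (C t) ha
        rw [Finset.mul_sum] at this
        simpa [mul_assoc] using this }
  have hW : W < ⊤ := by
    refine lt_top_iff_ne_top.2 fun h => hj ?_
    have : (Pi.single j 1 : Fin m → k) ∈ W := h ▸ Submodule.mem_top
    have h2 : ∑ i, C ((Pi.single j 1 : Fin m → k) i) * X i ∈ P := this
    rw [Finset.sum_eq_single j] at h2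
    · simpa using h2
    · intro b _ hb; simp [Pi.single_eq_of_ne hb]
    · simp
  obtain ⟨f, hf, hfW⟩ := Submodule.exists_le_ker_of_lt_top W hW
  have hev : ∀ c, eval c (∑ i, C (f (Pi.single i 1)) * X i : MvPolynomial (Fin m) k) = f c := by
    intro c
    conv_rhs => rw [pi_eq_sum_univ' c, map_sum]
    rw [map_sum]
    refine Finset.sum_congr rfl fun i _ => ?_
    rw [map_smul]
    simp only [map_mul, eval_C, eval_X, smul_eq_mul]
    rw [mul_comm]
  refine ⟨∑ i, C (f (Pi.single i 1)) * X i, ?_, ?_⟩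
  · intro h0
    refine hf (LinearMap.ext fun c => ?_)
    rw [← hev c, h0]; simp
  · intro c hc
    rw [hev]
    exact hfW hc

theorem bt_eval_smul {k : Type*} [Field k] {m : ℕ} {f : MvPolynomial (Fin m) k} {d : ℕ}
    (hf : f.IsHomogeneous d) (t : k) (p : Fin m → k) :
    eval (t • p) f = t ^ d * eval p f := by
  rw [eval_eq, eval_eq, Finset.mul_sum]
  refine Finset.sum_congr rfl fun e he => ?_
  have h1 := hf (mem_support_iff.1 he)
  rw [Finsupp.weight_apply, Finsupp.sum] at h1
  simp only [Pi.smul_apply, smul_eq_mul, mul_pow, Finset.prod_mul_distrib]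
  rw [Finset.prod_pow_eq_pow_sum]
  simp at h1
  rw [h1]; ring

theorem bt_small_tangent {k : Type*} [Field k] [Infinite k] (n r : ℕ)
    (hr : r ≤ n) (F : Fin r → MvPolynomial (Fin (n + 1)) k) (d : Fin r → ℕ)
    (hhom : ∀ i, (F i).IsHomogeneous (d i))
    (hdim : ringKrullDim (MvPolynomial (Fin (n + 1)) k ⧸ Ideal.span (Set.range F)) ≤ (n - r + 1 : ℕ))
    (j : Fin (n + 1)) :
    BtSmall {c : Fin (n + 1) → k | ∃ p : Fin (n + 1) → k, p j ≠ 0 ∧ (∀ i, eval p (F i) = 0) ∧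
      c ∈ Submodule.span k (Set.range fun i => fun l => eval p (pderiv l (F i)))} := by
  set I := Ideal.span (Set.range F) with hI
  -- choice of the affine slice
  obtain ⟨a, ha0, ha⟩ : ∃ a : k, a ≠ 0 ∧ ∀ P ∈ I.minimalPrimes, X j - C a ∉ P := by
    have hfin := I.finite_minimalPrimes_of_isNoetherianRing
    have hs : (⋃ P ∈ I.minimalPrimes, {a : k | X j - C a ∈ P}).Finite := by
      refine hfin.biUnion fun P hP => Set.Subsingleton.finite ?_
      intro a ha b hb
      by_contra hne
      have h1 : C (b - a) ∈ P := by
        have := P.sub_mem ha hb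
        simpa using this
      exact hP.1.1.ne_top (Ideal.eq_top_of_isUnit_mem _ h1
        ((isUnit_iff_ne_zero.2 (sub_ne_zero.2 (Ne.symm hne))).map C))
    obtain ⟨a, ha⟩ := (hs.union (Set.finite_singleton (0 : k))).exists_notMem
    simp only [Set.mem_union, Set.mem_iUnion, Set.mem_singleton_iff, not_or, not_exists] at ha
    exact ⟨a, ha.2, fun P hP h => ha.1 P hP h⟩
  have hA := bt_cut I (X j - C a) (n - r) (fun P hP => Or.inl (ha P hP)) hdim
  set K := I ⊔ Ideal.span {X j - C a} with hK
  let f : MvPolynomial (Fin (n + 1)) k →ₐ[k]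
      MvPolynomial (Fin r) (MvPolynomial (Fin (n + 1)) k ⧸ K) :=
    aeval fun l => ∑ i, C (Ideal.Quotient.mk K (pderiv l (F i))) * X i
  have hB : ringKrullDim (MvPolynomial (Fin r) (MvPolynomial (Fin (n + 1)) k ⧸ K)) < (n + 1 : ℕ) := by
    rw [MvPolynomial.ringKrullDim_of_isNoetherianRing]
    refine lt_of_le_of_lt (b := ((n : ℕ) : WithBot ℕ∞)) ?_ (by exact_mod_cast Nat.lt_succ_self n)
    refine (add_le_add_left hA _).trans ?_
    rw [Nat.card_fin, ← Nat.cast_add, Nat.sub_add_cancel hr]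
  have : Algebra.FiniteType k (MvPolynomial (Fin r) (MvPolynomial (Fin (n + 1)) k ⧸ K)) :=
    Algebra.FiniteType.trans (S := MvPolynomial (Fin (n + 1)) k ⧸ K) inferInstance inferInstance
  obtain ⟨g, hg, hfg⟩ := bt_not_inj k
    (B := MvPolynomial (Fin r) (MvPolynomial (Fin (n + 1)) k ⧸ K)) (n + 1) hB f
  refine ⟨g, hg, ?_⟩
  rintro c ⟨p, hp, hF, hc⟩
  obtain ⟨lam, hlam⟩ := (Submodule.mem_span_range_iff_exists_fun k).1 hc
  set t := a / p j with ht
  have ht0 : t ≠ 0 := div_ne_zero ha0 hp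
  have hKp : ∀ x ∈ K, eval (t • p) x = 0 := by
    have : K ≤ RingHom.ker (eval (t • p)) := by
      rw [hK, hI]
      refine sup_le (Ideal.span_le.2 ?_) (Ideal.span_le.2 ?_)
      · rintro _ ⟨i, rfl⟩
        change eval (t • p) (F i) = 0
        rw [bt_eval_smul (hhom i), hF i, mul_zero]
      · rintro _ rfl
        change eval (t • p) (X j - C a) = 0
        simp [ht, hp]
    exact fun x hx => this hx
  let ev : MvPolynomial (Fin r) (MvPolynomial (Fin (n + 1)) k ⧸ K) →+* k :=
    eval₂Hom (Ideal.Quotient.lift K (eval (t • p)) hKp) (fun i => lam i * (t ^ (d i - 1))⁻¹)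
  have hcomp : ev.comp f.toRingHom = eval c := by
    refine MvPolynomial.ringHom_ext (fun b => ?_) (fun l => ?_)
    · have : f (C b) = C (Ideal.Quotient.mk K (C b)) := f.commutes b
      change ev (f (C b)) = _
      rw [this]
      simp [ev]
    · change ev (f (X l)) = _
      simp only [f, aeval_X, map_sum, map_mul, ev, coe_eval₂Hom, eval₂_C, eval₂_X, 
        Ideal.Quotient.lift_mk, eval_X]
      rw [← hlam, Finset.sum_apply]
      refine Finset.sum_congr rfl fun i _ => ?_
      rw [bt_eval_smul (hhom i).pderiv]
      simp only [Pi.smul_apply, smul_eq_mul]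
      have := pow_ne_zero (d i - 1) ht0
      field_simp
  rw [← hcomp]
  change ev (f g) = 0
  rw [hfg, map_zero]

theorem bt_wb_le (a : WithBot ℕ∞) (M N : ℕ) (ha : a ≤ M) (h : projDimOf a ≤ N) :
    a ≤ (N + 1 : ℕ) := by
  induction a using WithBot.recBotCoe with
  | bot => exact bot_le
  | coe e =>
    have he : e ≤ M := by exact_mod_cast ha
    obtain ⟨m, rfl⟩ := ENat.ne_top_iff_exists.1 (ne_top_of_le_ne_top (ENat.natCast_ne_top M) he)
    simp only [projDimOf, wbToInt, WithBot.recBotCoe_coe, ENat.toNat_natCast] at h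
    have : m ≤ N + 1 := by omega
    exact_mod_cast this

theorem bt_proj_le (a : WithBot ℕ∞) (N : ℕ) (ha : a ≤ N) : projDimOf a ≤ (N : ℤ) - 1 := by
  induction a using WithBot.recBotCoe with
  | bot =>
    simp only [projDimOf, wbToInt, WithBot.recBotCoe_bot]
    omega
  | coe e =>
    have he : e ≤ N := by exact_mod_cast ha
    obtain ⟨m, rfl⟩ := ENat.ne_top_iff_exists.1 (ne_top_of_le_ne_top (ENat.natCast_ne_top N) he)
    simp only [projDimOf, wbToInt, WithBot.recBotCoe_coe, ENat.toNat_natCast]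
    have : m ≤ N := by exact_mod_cast he
    omega

theorem bt_proj_ge (a : WithBot ℕ∞) (M N : ℕ) (hM : a ≤ M) (ha : N ≤ a) :
    (N : ℤ) - 1 ≤ projDimOf a := by
  induction a using WithBot.recBotCoe with
  | bot => 
    have : ((N : ℕ∞) : WithBot ℕ∞) ≤ ⊥ := ha
    simp at this
  | coe e =>
    have he : e ≤ M := by exact_mod_cast hM
    obtain ⟨m, rfl⟩ := ENat.ne_top_iff_exists.1 (ne_top_of_le_ne_top (ENat.natCast_ne_top M) he)
    simp only [projDimOf, wbToInt, WithBot.recBotCoe_coe, ENat.toNat_natCast]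
    have : N ≤ m := by exact_mod_cast ha
    omega

/-- The pointwise Jacobian criterion for the hyperplane section. -/
theorem bt_jac {k : Type*} [Field k] (n r : ℕ)
    (F : Fin r → MvPolynomial (Fin (n + 1)) k) (c p : Fin (n + 1) → k)
    (hc : c ∉ Submodule.span k (Set.range fun i => fun l => eval p (pderiv l (F i))))
    (L : MvPolynomial (Fin (n + 1)) k) (hL : L = ∑ j, C (c j) * X j)
    (h : ∀ sel : Fin (r + 1) → Fin (n + 1), eval p (Matrix.of fun i t : Fin (r + 1) =>
      pderiv (sel t) ((Fin.snoc F L : Fin (r + 1) → MvPolynomial (Fin (n + 1)) k) i)).det = 0)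
    (sel : Fin r → Fin (n + 1)) :
    eval p (Matrix.of fun i t : Fin r => pderiv (sel t) (F i)).det = 0 := by
  by_contra hne
  rw [RingHom.map_det] at hne
  have hv := bt_indep (fun i l => eval p (pderiv l (F i))) sel hne
  have hw := linearIndependent_finSnoc.2 ⟨hv, hc⟩
  obtain ⟨sel', hs⟩ := bt_minor _ hw
  apply hs
  rw [← h sel', RingHom.map_det]
  congr 1
  ext i t
  refine Fin.lastCases ?_ (fun i => ?_) i
  · simp only [Matrix.of_apply, Fin.snoc_last, RingHom.mapMatrix_apply, Matrix.map_apply, hL,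
      map_sum, pderiv_C_mul]
    simp [pderiv_X, Pi.single_apply, apply_ite (eval p)]
  · simp

/-- Bertini-type lemma: let `X ⊆ ℙⁿ_k` (`k` algebraically closed) be a nonempty complete
intersection cut out by forms `F₁,…,F_r` (so `dim X = n - r`, `r ≤ n`) with
`dim Sing X = s`, the singular locus being cut out by the `r × r` minors of the Jacobian.
Then there is a hyperplane `H = {∑ cⱼ xⱼ = 0}` with `dim (X ∩ H) = dim X - 1` and
`dim Sing (X ∩ H) < max(s, 0)`, where `Sing (X ∩ H)` is cut out by the `(r+1) × (r+1)`
minors of the Jacobian of `(F₁,…,F_r, ∑ cⱼ xⱼ)`; `dim ∅ = -1`. -/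
theorem bertini_hyperplane_section (k : Type*) [Field k] [IsAlgClosed k] (n r : ℕ)
    (hr : r ≤ n) (F : Fin r → MvPolynomial (Fin (n + 1)) k) (d : Fin r → ℕ)
    (hhom : ∀ i, (F i).IsHomogeneous (d i)) (hd : ∀ i, 0 < d i)
    (I : Ideal (MvPolynomial (Fin (n + 1)) k)) (hI : I = Ideal.span (Set.range F))
    (hci : projDimOf (ringKrullDim (MvPolynomial (Fin (n + 1)) k ⧸ I)) = (n : ℤ) - r)
    (s : ℤ)
    (hs : projDimOf (ringKrullDim (MvPolynomial (Fin (n + 1)) k ⧸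
        (I ⊔ Ideal.span (Set.range fun c : Fin r → Fin (n + 1) =>
          (Matrix.of fun i t : Fin r => pderiv (c t) (F i)).det)))) = s) :
    ∃ c : Fin (n + 1) → k, c ≠ 0 ∧
      (∀ L : MvPolynomial (Fin (n + 1)) k, L = ∑ j, MvPolynomial.C (c j) * X j →
        projDimOf (ringKrullDim (MvPolynomial (Fin (n + 1)) k ⧸
            (I ⊔ Ideal.span {L}))) = (n : ℤ) - r - 1 ∧
        projDimOf (ringKrullDim (MvPolynomial (Fin (n + 1)) k ⧸
            (I ⊔ Ideal.span {L} ⊔ Ideal.span (Set.range fun sel : Fin (r + 1) → Fin (n + 1) =>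
              (Matrix.of fun i t : Fin (r + 1) =>
                pderiv (sel t) ((Fin.snoc F L : Fin (r + 1) → MvPolynomial (Fin (n + 1)) k) i)).det))))
          < max s 0) := by
  have hRdim : ringKrullDim (MvPolynomial (Fin (n + 1)) k) = (n + 1 : ℕ) := by
    rw [MvPolynomial.ringKrullDim_of_isNoetherianRing, ringKrullDim_eq_zero_of_field]
    simp
  have hbd : ∀ K : Ideal (MvPolynomial (Fin (n + 1)) k), ringKrullDim ((MvPolynomial (Fin (n + 1)) k) ⧸ K) ≤ (n + 1 : ℕ) := fun K =>
    (ringKrullDim_quotient_le K).trans hRdim.le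
  have hInf : Infinite k := IsAlgClosed.instInfinite
  have hIdim : ringKrullDim ((MvPolynomial (Fin (n + 1)) k) ⧸ I) ≤ (n - r + 1 : ℕ) :=
    bt_wb_le _ (n + 1) (n - r) (hbd I) (by rw [hci]; omega)
  set J := I ⊔ Ideal.span (Set.range fun c : Fin r → Fin (n + 1) =>
          (Matrix.of fun i t : Fin r => pderiv (c t) (F i)).det) with hJ
  have hJdim : ringKrullDim ((MvPolynomial (Fin (n + 1)) k) ⧸ J) ≤ (s.toNat + 1 : ℕ) :=
    bt_wb_le _ (n + 1) s.toNat (hbd J) (by rw [hs]; omega)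
  -- the maximal ideal of the origin
  let m : Ideal (MvPolynomial (Fin (n + 1)) k) := vanishingIdeal k {(0 : Fin (n + 1) → k)}
  have hm : m.IsMaximal := isMaximal_iff_eq_vanishingIdeal_singleton.2 ⟨0, rfl⟩
  have hmP : ∀ P : Ideal (MvPolynomial (Fin (n + 1)) k), P ≠ ⊤ → (∀ j, X j ∈ P) → P.IsMaximal := by
    intro P hP h
    have : m ≤ P := by
      intro f hf
      have h0 : aeval (0 : Fin (n + 1) → k) f = 0 := (mem_vanishingIdeal_singleton_iff _ _).1 hf
      have h1 : ∀ g : (MvPolynomial (Fin (n + 1)) k), g - C (aeval (0 : Fin (n + 1) → k) g) ∈ P := by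
        intro g
        induction g using MvPolynomial.induction_on with
        | C a => simp
        | add p q hp hq =>
          have := P.add_mem hp hq
          rw [map_add, map_add]
          convert this using 1
          ring
        | mul_X p j hp => 
          rw [map_mul]
          simpa using P.mul_mem_left p (h j)
      have := h1 f
      rwa [h0, map_zero, sub_zero] at this
    rw [← hm.eq_of_le hP this]; exact hm
  -- the bad sets
  have hsmallP : ∀ K : Ideal (MvPolynomial (Fin (n + 1)) k), BtSmall (⋃ P : {P : Ideal (MvPolynomial (Fin (n + 1)) k) // P ∈ K.minimalPrimes},
      {c : Fin (n + 1) → k | ∑ i, C (c i) * X i ∈ P.1 ∧ ¬ P.1.IsMaximal}) := by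
    intro K
    have := K.finite_minimalPrimes_of_isNoetherianRing.to_subtype
    refine BtSmall.iUnion (ι := {P : Ideal (MvPolynomial (Fin (n + 1)) k) // P ∈ K.minimalPrimes}) ?_
    rintro ⟨P, hP⟩
    by_cases hmax : P.IsMaximal
    · exact ⟨1, one_ne_zero, fun c hc => (hc.2 hmax).elim⟩
    · have : ∃ j, X j ∉ P := by
        by_contra! hall
        exact hmax (hmP P hP.1.1.ne_top hall)
      obtain ⟨j, hj⟩ := this
      obtain ⟨g, hg, hz⟩ := bt_small_prime P j hj
      exact ⟨g, hg, fun c hc => hz c hc.1⟩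
  have hT := BtSmall.iUnion (fun j => bt_small_tangent n r hr F d hhom (hI ▸ hIdim) j)
  obtain ⟨c, hc⟩ :=
    (((bt_small_zero (k := k) (0 : Fin (n + 1))).union (hsmallP I)).union
      ((hsmallP J).union hT)).exists_notMem
  simp only [Set.mem_union, not_or, Set.mem_singleton_iff, Set.mem_iUnion, not_exists] at hc
  obtain ⟨⟨hc0, hcI⟩, hcJ, hcT⟩ := hc
  refine ⟨c, hc0, fun L hL => ⟨?_, ?_⟩⟩
  · apply le_antisymm
    · have h1 := bt_cut I L (n - r) (fun P hP => by
        by_contra! hcon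
        exact hcI ⟨P, hP⟩ ⟨hL ▸ hcon.1, hcon.2⟩) hIdim
      have := bt_proj_le _ _ h1
      rw [Nat.cast_sub hr] at this
      exact this
    · have hsp : I ⊔ Ideal.span {L} = Ideal.span (Set.range F ∪ {L}) := by
        rw [hI, Ideal.span_union]
      have hmem : (Set.range F ∪ {L}) ⊆ (m : Set (MvPolynomial (Fin (n + 1)) k)) := by
        rintro f (⟨i, rfl⟩ | rfl)
        · refine (mem_vanishingIdeal_singleton_iff _ _).2 ?_
          have := bt_eval_smul (hhom i) 0 (0 : Fin (n + 1) → k)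
          rw [zero_pow (hd i).ne', zero_mul, smul_zero] at this
          rw [aeval_eq_eval]; exact this
        · refine (mem_vanishingIdeal_singleton_iff _ _).2 ?_
          rw [hL]; simp
      have h1 := Ideal.height_le_ringKrullDim_quotient_add_encard (p := m) _ hmem
      rw [← hsp] at h1
      have h2 : (Set.range F ∪ {L}).encard ≤ (r + 1 : ℕ) := by
        refine (Set.encard_union_le _ _).trans ?_
        rw [Set.encard_singleton, Nat.cast_add, Nat.cast_one]
        gcongr
        rw [← Set.image_univ]
        refine (Set.encard_image_le _ _).trans ?_
        simp
      have h3 := bt_height k (n + 1)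
      have h4 : ((n + 1 : ℕ) : WithBot ℕ∞) ≤ ringKrullDim ((MvPolynomial (Fin (n + 1)) k) ⧸ (I ⊔ Ideal.span {L})) + (r + 1 : ℕ) := by
        refine le_trans ?_ (h1.trans ?_)
        · exact_mod_cast h3
        · gcongr
          exact_mod_cast h2
      have h5 : ((n - r : ℕ) : WithBot ℕ∞) ≤ ringKrullDim ((MvPolynomial (Fin (n + 1)) k) ⧸ (I ⊔ Ideal.span {L})) := by
        have hb := hbd (I ⊔ Ideal.span {L})
        generalize ringKrullDim ((MvPolynomial (Fin (n + 1)) k) ⧸ (I ⊔ Ideal.span {L})) = a at h4 hb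
        induction a using WithBot.recBotCoe with
        | bot => 
          rw [WithBot.bot_add] at h4
          have : (((n + 1 : ℕ) : ℕ∞) : WithBot ℕ∞) ≤ ⊥ := h4
          simp at this
        | coe e =>
          have he : e ≤ (n + 1 : ℕ) := by exact_mod_cast hb
          obtain ⟨q, rfl⟩ := ENat.ne_top_iff_exists.1 (ne_top_of_le_ne_top (ENat.natCast_ne_top _) he)
          have h6 : n + 1 ≤ q + (r + 1) := by exact_mod_cast h4
          have h7 : n - r ≤ q := by omega
          have h8 : ((n - r : ℕ) : ℕ∞) ≤ (q : ℕ∞) := Nat.cast_le.2 h7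
          exact WithBot.coe_le_coe.2 h8
      have := bt_proj_ge _ _ _ (hbd _) h5
      rw [Nat.cast_sub hr] at this
      exact this
  · set K := I ⊔ Ideal.span {L} ⊔ Ideal.span (Set.range fun sel : Fin (r + 1) → Fin (n + 1) =>
              (Matrix.of fun i t : Fin (r + 1) =>
                pderiv (sel t) ((Fin.snoc F L : Fin (r + 1) → MvPolynomial (Fin (n + 1)) k) i)).det)
      with hK
    have h1 := bt_cut J L s.toNat (fun P hP => by
        by_contra! hcon
        exact hcJ ⟨P, hP⟩ ⟨hL ▸ hcon.1, hcon.2⟩) hJdim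
    have hIK : ∀ i, F i ∈ K := fun i => by
      refine Ideal.mem_sup_left (Ideal.mem_sup_left ?_)
      rw [hI]; exact Ideal.subset_span ⟨i, rfl⟩
    have h2 : ((J ⊔ Ideal.span {L}) ⊓ m) ≤ K.radical := by
      rw [← vanishingIdeal_zeroLocus_eq_radical (K := k)]
      intro f hf p hp
      by_cases hp0 : p = 0
      · rw [hp0]; exact (mem_vanishingIdeal_singleton_iff _ _).1 hf.2
      · obtain ⟨j, hj⟩ := Function.ne_iff.1 hp0
        have hpK : ∀ x ∈ K, eval p x = 0 := fun x hx => by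
          have := hp x hx
          rwa [aeval_eq_eval] at this
        have hle : J ⊔ Ideal.span {L} ≤ RingHom.ker (eval p) := by
          rw [hJ]
          refine sup_le (sup_le ?_ ?_) ?_
          · exact fun x hx => hpK x (Ideal.mem_sup_left (Ideal.mem_sup_left hx))
          · rw [Ideal.span_le]
            rintro _ ⟨sel, rfl⟩
            refine bt_jac n r F c p ?_ L hL ?_ sel
            · intro hmem
              exact hcT j ⟨p, hj, fun i => hpK _ (hIK i), hmem⟩
            · intro sel'
              exact hpK _ (Ideal.mem_sup_right (Ideal.subset_span ⟨sel', rfl⟩))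
          · exact fun x hx => hpK x (Ideal.mem_sup_left (Ideal.mem_sup_right hx))
        rw [aeval_eq_eval]
        exact hle hf.1
    have h3 : ringKrullDim ((MvPolynomial (Fin (n + 1)) k) ⧸ K) ≤ s.toNat := by
      refine bt_compare K (J ⊔ Ideal.span {L}) _ (fun q hq hKq => ?_) h1
      have h4 : (J ⊔ Ideal.span {L}) ⊓ m ≤ q := h2.trans (hq.radical_le_iff.2 hKq)
      rcases hq.inf_le.1 h4 with h | h
      · exact Or.inl h
      · right; rw [← hm.eq_of_le hq.ne_top h]; exact hm
    have := bt_proj_le _ _ h3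
    omega
end

section
/- Let $X$ be a projective variety over a field $k$ and $H$ a hyperplane in $\mathbb{P}^n_k$ such that $\dim(X \cap H) = \dim X - 1$. Then $\dim\mathrm{Sing}(X \cap H) \geq \dim\mathrm{Sing}\, X - 1$. -/
open MvPolynomial

theorem katz_height_max (k : Type*) [Field k] (r : ℕ) :
    ∀ M : Ideal (MvPolynomial (Fin r) k), M.IsMaximal → (r : ℕ∞) ≤ M.height := by
  induction r with
  | zero => intro M _; simp
  | succ r ih =>
    intro M hM
    let e := (finSuccEquiv k r).toRingEquiv
    have hP : (M.map e).IsMaximal := Ideal.map_isMaximal_of_equiv e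
    have hp : ((M.map e).under (MvPolynomial (Fin r) k)).IsMaximal :=
      Polynomial.isMaximal_comap_C_of_isJacobsonRing (M.map e)
    have : (M.map e).LiesOver ((M.map e).under (MvPolynomial (Fin r) k)) := ⟨rfl⟩
    have h1 := Polynomial.height_eq_height_add_one
      ((M.map e).under (MvPolynomial (Fin r) k)) (M.map e)
    rw [← e.height_map M, h1]
    push_cast
    gcongr
    exact ih _ hp

theorem katz_dim_le_height (k A : Type*) [Field k] [CommRing A] [IsDomain A] [Algebra k A]
    [Algebra.FiniteType k A] (M : Ideal A) [hM : M.IsMaximal] :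
    ringKrullDim A ≤ (M.height : WithBot ℕ∞) := by
  obtain ⟨r, g, hinj, hint⟩ := exists_integral_inj_algHom_of_fg k A
  let := g.toRingHom.toAlgebra
  have : Algebra.IsIntegral (MvPolynomial (Fin r) k) A := ⟨hint⟩
  have : FaithfulSMul (MvPolynomial (Fin r) k) A :=
    (faithfulSMul_iff_algebraMap_injective _ _).mpr hinj
  have : IsNoetherianRing A := Algebra.FiniteType.isNoetherianRing k A
  let p := M.under (MvPolynomial (Fin r) k)
  have hp : p.IsMaximal := Ideal.isMaximal_comap_of_isIntegral_of_isMaximal M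
  have h1 : (r : ℕ∞) ≤ M.height := by
    rw [Ideal.height_eq_height_add_of_liesOver_of_hasGoingDown p M]
    exact (katz_height_max k r p hp).trans le_self_add
  have h2 : ringKrullDim A ≤ ringKrullDim (MvPolynomial (Fin r) k) := by
    refine Order.krullDim_le_of_strictMono
      (PrimeSpectrum.comap (algebraMap (MvPolynomial (Fin r) k) A)) ?_
    intro P Q h
    exact Ideal.IsIntegral.comap_lt_comap h
  refine h2.trans ?_
  rw [MvPolynomial.ringKrullDim_of_isNoetherianRing]
  simp
  exact_mod_cast h1

section katzGraded

attribute [local instance] MvPolynomial.gradedAlgebra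

theorem katz_hom_le {k : Type*} [Field k] {N : ℕ} (P : Ideal (MvPolynomial (Fin N) k))
    (hP : P ≠ ⊤) (hh : P.IsHomogeneous (homogeneousSubmodule (Fin N) k)) :
    P ≤ RingHom.ker (constantCoeff : MvPolynomial (Fin N) k →+* k) := by
  intro f hf
  have h : homogeneousComponent 0 f ∈ P := by
    rw [← MvPolynomial.decomposition.decompose'_apply]
    exact hh 0 hf
  by_contra hne
  apply hP
  simp only [homogeneousComponent_zero] at h
  refine Ideal.eq_top_of_isUnit_mem _ h ?_
  refine IsUnit.map C (isUnit_iff_ne_zero.mpr ?_)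
  exact hne

theorem katz_dim_section {k : Type*} [Field k] {N : ℕ} (J : Ideal (MvPolynomial (Fin N) k))
    (hh : J.IsHomogeneous (homogeneousSubmodule (Fin N) k))
    (L : MvPolynomial (Fin N) k) (hL : constantCoeff L = 0) :
    ringKrullDim (MvPolynomial (Fin N) k ⧸ J) ≤
      ringKrullDim (MvPolynomial (Fin N) k ⧸ (J ⊔ Ideal.span {L})) + 1 := by
  rw [ringKrullDim_quotient J]
  refine iSup_le fun p => ?_
  let P := p.head.1.asIdeal
  have hJP : J ≤ P := p.head.2
  have hPp : P.IsPrime := p.head.1.isPrime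
  let P' := (P.homogeneousCore (homogeneousSubmodule (Fin N) k)).toIdeal
  have hP' : P'.IsPrime := Ideal.IsPrime.homogeneousCore hPp
  have hP'P : P' ≤ P := Ideal.toIdeal_homogeneousCore_le _ _
  have hJP' : J ≤ P' := by
    have := Ideal.homogeneousCore_mono (homogeneousSubmodule (Fin N) k) hJP
    have h2 := hh.toIdeal_homogeneousCore_eq_self
    rw [← h2]
    exact this
  let M := RingHom.ker (constantCoeff : MvPolynomial (Fin N) k →+* k)
  have hM : M.IsMaximal := RingHom.ker_isMaximal_of_surjective _ (fun a => ⟨C a, by simp⟩)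
  have hP'M : P' ≤ M := katz_hom_le P' hP'.ne_top (HomogeneousIdeal.isHomogeneous _)
  have h1 : (p.length : WithBot ℕ∞) ≤ ringKrullDim (MvPolynomial (Fin N) k ⧸ P') := by
    rw [ringKrullDim_quotient P']
    let F : LTSeries (PrimeSpectrum.zeroLocus (P' : Set (MvPolynomial (Fin N) k))) :=
      { length := p.length
        toFun := fun i => ⟨(p i).1, hP'P.trans (show p.head.1 ≤ (p i).1 from p.head_le i)⟩
        step := fun i => p.step i }
    exact Order.LTSeries.length_le_krullDim F
  let q := Ideal.Quotient.mk P'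
  have : (M.map q).IsMaximal := Ideal.IsMaximal.map_of_surjective_of_ker_le
    Ideal.Quotient.mk_surjective (by rw [Ideal.mk_ker]; exact hP'M)
  have h2 := katz_dim_le_height k _ (M.map q)
  have h3 := Ideal.height_le_ringKrullDim_quotient_add_one (p := M.map q) (r := q L)
    (Ideal.mem_map_of_mem q hL)
  refine h1.trans (h2.trans (h3.trans ?_))
  gcongr
  have : J ⊔ Ideal.span {L} ≤ RingHom.ker ((Ideal.Quotient.mk (Ideal.span {q L})).comp q) := by
    refine sup_le (fun x hx => ?_) ?_
    · have : q x = 0 := Ideal.Quotient.eq_zero_iff_mem.mpr (hJP' hx)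
      simp [RingHom.mem_ker, this]
    · rw [Ideal.span_singleton_le_iff_mem, RingHom.mem_ker, RingHom.comp_apply,
        Ideal.Quotient.eq_zero_iff_mem]
      exact Ideal.mem_span_singleton_self _
  refine ringKrullDim_le_of_surjective (Ideal.Quotient.lift _ _ this) ?_
  exact Ideal.Quotient.lift_surjective_of_surjective _ _
    (Ideal.Quotient.mk_surjective.comp Ideal.Quotient.mk_surjective)

theorem katz_det_hom {k : Type*} [Field k] {N m c : ℕ} (G : Fin m → MvPolynomial (Fin N) k)
    (d : Fin m → ℕ) (hhom : ∀ i, (G i).IsHomogeneous (d i))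
    (a : Fin c → Fin m) (b : Fin c → Fin N) :
    ((Matrix.of fun i t : Fin c => pderiv (b t) (G (a i))).det).IsHomogeneous
      (∑ i, (d (a i) - 1)) := by
  rw [← Matrix.det_transpose, Matrix.det_apply']
  refine IsHomogeneous.sum _ _ _ fun σ _ => ?_
  have h : (((Equiv.Perm.sign σ : ℤ) : MvPolynomial (Fin N) k)).IsHomogeneous 0 := by
    have : ((Equiv.Perm.sign σ : ℤ) : MvPolynomial (Fin N) k) = C ((Equiv.Perm.sign σ : ℤ) : k) := by
      simp
    rw [this]; exact isHomogeneous_C _ _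
  rw [← zero_add (∑ i, (d (a i) - 1))]
  refine h.mul (IsHomogeneous.prod _ _ _ fun i _ => ?_)
  exact (hhom _).pderiv

theorem katz_det_mem {k : Type*} [Field k] {N m c : ℕ} (G : Fin m → MvPolynomial (Fin N) k)
    (L : MvPolynomial (Fin N) k) (a : Fin (c + 1) → Fin (m + 1)) (b : Fin (c + 1) → Fin N) :
    (Matrix.of fun i t : Fin (c + 1) =>
      pderiv (b t) ((Fin.snoc G L : Fin (m + 1) → MvPolynomial (Fin N) k) (a i))).det ∈
    Ideal.span (Set.range fun sel : (Fin c → Fin m) × (Fin c → Fin N) =>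
          (Matrix.of fun i t : Fin c => pderiv (sel.2 t) (G (sel.1 i))).det) := by
  -- if there is a row whose complement avoids `L`, expand along it
  have key : ∀ i : Fin (c + 1), (∀ j, a (i.succAbove j) ≠ Fin.last m) →
      (Matrix.of fun i t : Fin (c + 1) =>
      pderiv (b t) ((Fin.snoc G L : Fin (m + 1) → MvPolynomial (Fin N) k) (a i))).det ∈
    Ideal.span (Set.range fun sel : (Fin c → Fin m) × (Fin c → Fin N) =>
          (Matrix.of fun i t : Fin c => pderiv (sel.2 t) (G (sel.1 i))).det) := by
    intro i hi
    rw [Matrix.det_succ_row _ i]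
    refine Ideal.sum_mem _ fun j _ => Ideal.mul_mem_left _ _ (Ideal.subset_span ?_)
    refine ⟨(fun t => (a (i.succAbove t)).castPred (hi t), fun t => b (j.succAbove t)), ?_⟩
    dsimp only
    congr 1
    ext1 s t
    simp only [Matrix.of_apply, Matrix.submatrix_apply]
    conv_rhs => rw [← Fin.castSucc_castPred (a (i.succAbove s)) (hi s), Fin.snoc_castSucc]
  by_cases h : ∃ i, a i = Fin.last m
  · obtain ⟨i, hi⟩ := h
    by_cases h2 : ∃ j, a (i.succAbove j) = Fin.last m
    · obtain ⟨j, hj⟩ := h2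
      rw [Matrix.det_zero_of_row_eq (Fin.succAbove_ne i j)]
      · exact Ideal.zero_mem _
      · ext1 t; simp [hi, hj]
    · exact key i (by simpa using h2)
  · exact key 0 fun j hj => h ⟨_, hj⟩

theorem katz_sing_hom {k : Type*} [Field k] {N m c : ℕ} (G : Fin m → MvPolynomial (Fin N) k)
    (d : Fin m → ℕ) (hhom : ∀ i, (G i).IsHomogeneous (d i)) :
    (Ideal.span (Set.range G) ⊔ Ideal.span (Set.range
      fun sel : (Fin c → Fin m) × (Fin c → Fin N) =>
        (Matrix.of fun i t : Fin c => pderiv (sel.2 t) (G (sel.1 i))).det)).IsHomogeneous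
      (homogeneousSubmodule (Fin N) k) := by
  refine Ideal.IsHomogeneous.sup (Ideal.homogeneous_span _ _ ?_) (Ideal.homogeneous_span _ _ ?_)
  · rintro _ ⟨i, rfl⟩
    exact ⟨d i, hhom i⟩
  · rintro _ ⟨sel, rfl⟩
    exact ⟨_, katz_det_hom G d hhom sel.1 sel.2⟩

theorem katz_dim_main {k : Type*} [Field k] {N m c : ℕ} (G : Fin m → MvPolynomial (Fin N) k)
    (d : Fin m → ℕ) (hhom : ∀ i, (G i).IsHomogeneous (d i))
    (L : MvPolynomial (Fin N) k) (hL : constantCoeff L = 0) :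
    ringKrullDim (MvPolynomial (Fin N) k ⧸ (Ideal.span (Set.range G) ⊔
      Ideal.span (Set.range fun sel : (Fin c → Fin m) × (Fin c → Fin N) =>
        (Matrix.of fun i t : Fin c => pderiv (sel.2 t) (G (sel.1 i))).det))) ≤
    ringKrullDim (MvPolynomial (Fin N) k ⧸ (Ideal.span (Set.range G) ⊔ Ideal.span {L} ⊔
      Ideal.span (Set.range fun sel : (Fin (c + 1) → Fin (m + 1)) × (Fin (c + 1) → Fin N) =>
        (Matrix.of fun i t : Fin (c + 1) => pderiv (sel.2 t)
          ((Fin.snoc G L : Fin (m + 1) → MvPolynomial (Fin N) k) (sel.1 i))).det))) + 1 := by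
  refine (katz_dim_section _ (katz_sing_hom G d hhom) L hL).trans ?_
  gcongr
  refine ringKrullDim_le_of_surjective (Ideal.Quotient.factor ?_) (Ideal.Quotient.factor_surjective _)
  refine sup_le (sup_le (le_sup_left.trans le_sup_left) le_sup_right) ?_
  refine Ideal.span_le.mpr ?_
  rintro _ ⟨sel, rfl⟩
  exact Ideal.mem_sup_left (Ideal.mem_sup_right (katz_det_mem G L sel.1 sel.2))

end katzGraded

theorem katz_projDim {a b : WithBot ℕ∞} (ha : a ≠ ⊤) (hb : b ≠ ⊤) (h : a ≤ b + 1) :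
    projDimOf a - 1 ≤ projDimOf b := by
  induction a using WithBot.recBotCoe with
  | bot =>
    simp only [projDimOf, wbToInt, WithBot.recBotCoe_bot]
    have := le_max_right (wbToInt b - 1) (-1)
    simp only [wbToInt] at this
    omega
  | coe x =>
    induction b using WithBot.recBotCoe with
    | bot => simp at h
    | coe y =>
      lift x to ℕ using fun hx => ha (by rw [hx]; rfl)
      lift y to ℕ using fun hx => hb (by rw [hx]; rfl)
      have h' : x ≤ y + 1 := by exact_mod_cast h
      simp only [projDimOf, wbToInt, WithBot.recBotCoe_coe, ENat.toNat_natCast]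
      omega

theorem katz_quot_ne_top {k : Type*} [Field k] {N : ℕ} (J : Ideal (MvPolynomial (Fin N) k)) :
    ringKrullDim (MvPolynomial (Fin N) k ⧸ J) ≠ ⊤ := by
  refine ne_top_of_le_ne_top ?_ (ringKrullDim_quotient_le J)
  rw [MvPolynomial.ringKrullDim_of_isNoetherianRing, ringKrullDim_eq_zero_of_field, zero_add]
  exact WithBot.coe_injective.ne (ENat.natCast_ne_top (Nat.card (Fin N)))

/-- (Katz) Let `X ⊆ ℙⁿ_k` be a projective variety (cut out by the homogeneous prime ideal
`I = (G₁,…,G_m)`, of codimension `c`) and let `H = {∑ cⱼ xⱼ = 0}` be a hyperplane with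
`dim (X ∩ H) = dim X - 1`. Then `dim Sing (X ∩ H) ≥ dim Sing X - 1`, the singular loci
being cut out by the `c × c` (resp. `(c+1) × (c+1)`) minors of the Jacobians of `(G₁,…,G_m)`
(resp. `(G₁,…,G_m, ∑ cⱼ xⱼ)`); `dim ∅ = -1`. -/
theorem dim_sing_hyperplane_section_ge (k : Type*) [Field k] [IsAlgClosed k] (n m c : ℕ)
    (hc : c ≤ n) (G : Fin m → MvPolynomial (Fin (n + 1)) k) (d : Fin m → ℕ)
    (hhom : ∀ i, (G i).IsHomogeneous (d i))
    (I : Ideal (MvPolynomial (Fin (n + 1)) k)) (hI : I = Ideal.span (Set.range G))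
    (hprime : I.IsPrime)
    (hcodim : projDimOf (ringKrullDim (MvPolynomial (Fin (n + 1)) k ⧸ I)) = (n : ℤ) - c)
    (s : ℤ)
    (hs : projDimOf (ringKrullDim (MvPolynomial (Fin (n + 1)) k ⧸
        (I ⊔ Ideal.span (Set.range fun sel : (Fin c → Fin m) × (Fin c → Fin (n + 1)) =>
          (Matrix.of fun i t : Fin c => pderiv (sel.2 t) (G (sel.1 i))).det)))) = s)
    (co : Fin (n + 1) → k) (hco : co ≠ 0)
    (L : MvPolynomial (Fin (n + 1)) k) (hL : L = ∑ j, MvPolynomial.C (co j) * X j)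
    (hsect : projDimOf (ringKrullDim (MvPolynomial (Fin (n + 1)) k ⧸
        (I ⊔ Ideal.span {L}))) = (n : ℤ) - c - 1) :
    s - 1 ≤ projDimOf (ringKrullDim (MvPolynomial (Fin (n + 1)) k ⧸
        (I ⊔ Ideal.span {L} ⊔
          Ideal.span (Set.range fun sel : (Fin (c + 1) → Fin (m + 1)) × (Fin (c + 1) → Fin (n + 1)) =>
            (Matrix.of fun i t : Fin (c + 1) =>
              pderiv (sel.2 t)
                ((Fin.snoc G L : Fin (m + 1) → MvPolynomial (Fin (n + 1)) k) (sel.1 i))).det)))) := by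
  subst hs hI
  have hL0 : constantCoeff L = 0 := by
    rw [hL]; simp
  exact katz_projDim (katz_quot_ne_top _) (katz_quot_ne_top _) (katz_dim_main G d hhom L hL0)
end
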